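/- arXiv:1610.00164 — 4 statements merged into one kernel-verified Lean document; each statement's English description precedes it below -/
import Mathlib

section
/- For any \alpha_1,...,\alpha_M \in \mathbb{C} with |\alpha_m| \leq 1 for all m, and any positive integer N, \sup_{|z| \leq 1} \log|\prod_{m=1}^M (z - \alpha_m)| \leq (\log 2) \frac{M}{N+1} + \sum_{n=1}^N \frac{1}{n} |\sum_{m=1}^M \alpha_m^n|. -/
open ComplexConjugate in
/-- The Fourier expansion of `(1 - r²) |∑_{j ≤ N} (r ζ)^j|²` on the unit circle. -/
theorem one_sub_sq_mul_normSq_geom_sum (N : ℕ) (r : ℝ) (ζ : ℂ) (hζ : ‖ζ‖ = 1) :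
    (1 - r ^ 2) * ‖∑ j ∈ Finset.range (N + 1), ((r : ℂ) * ζ) ^ j‖ ^ 2 =
      1 - r ^ (2 * (N + 1)) +
        2 * (∑ n ∈ Finset.Icc 1 N, ((r ^ n - r ^ (2 * (N + 1) - n) : ℝ) : ℂ) * ζ ^ n).re := by
  set A := ∑ j ∈ Finset.range (N + 1), ((r : ℂ) * ζ) ^ j with hA
  set S := ∑ n ∈ Finset.Icc 1 N, ((r ^ n - r ^ (2 * (N + 1) - n) : ℝ) : ℂ) * ζ ^ n with hS
  have hζc : ζ * conj ζ = 1 := by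
    rw [Complex.mul_conj, Complex.normSq_eq_norm_sq, hζ]; simp
  have hIcc (x : ℂ) : ∑ n ∈ Finset.Icc 1 N, x ^ n = ∑ j ∈ Finset.range (N + 1), x ^ j - 1 := by
    rw [Finset.sum_range_succ', ← Finset.Ico_add_one_right_eq_Icc, Finset.sum_Ico_eq_sum_range]
    simp [add_comm]
  have hrefl (x : ℂ) : ∑ n ∈ Finset.Icc 1 N, x ^ (N + 1 - n) = ∑ n ∈ Finset.Icc 1 N, x ^ n := by
    refine Finset.sum_nbij' (fun n => N + 1 - n) (fun n => N + 1 - n) ?_ ?_ ?_ ?_ ?_ <;>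
      intro n hn <;> simp only [Finset.mem_Icc] at * <;> omega
  have hconjA : conj A = ∑ j ∈ Finset.range (N + 1), ((r : ℂ) * conj ζ) ^ j := by
    simp [hA]
  have hSA : S = (A - 1) - ((r : ℂ) * ζ) ^ (N + 1) * (conj A - 1) := by
    rw [hconjA, hA, ← hIcc, ← hIcc, ← hrefl ((r : ℂ) * conj ζ), Finset.mul_sum,
      ← Finset.sum_sub_distrib]
    refine Finset.sum_congr rfl fun n hn => ?_
    obtain ⟨k, hk⟩ : ∃ k, N + 1 = n + k := ⟨N + 1 - n, by
      simp only [Finset.mem_Icc] at hn; omega⟩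
    have h1 : N + 1 - n = k := by omega
    have h2 : 2 * (N + 1) - n = n + k + k := by omega
    have h3 : ζ ^ k * conj ζ ^ k = 1 := by rw [← mul_pow, hζc, one_pow]
    rw [h1, h2, hk]
    push_cast
    simp only [mul_pow, pow_add]
    linear_combination (r : ℂ) ^ n * r ^ k * r ^ k * ζ ^ n * h3
  have hgA : A * ((r : ℂ) * ζ - 1) = ((r : ℂ) * ζ) ^ (N + 1) - 1 := geom_sum_mul _ _
  have hgB : conj A * ((r : ℂ) * conj ζ - 1) = ((r : ℂ) * conj ζ) ^ (N + 1) - 1 := by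
    rw [hconjA]; exact geom_sum_mul _ _
  have hconjS : conj S = (conj A - 1) - ((r : ℂ) * conj ζ) ^ (N + 1) * (A - 1) := by
    rw [hSA]; simp
  have hww : ((r : ℂ) * ζ) * ((r : ℂ) * conj ζ) = (r : ℂ) ^ 2 := by
    linear_combination (r : ℂ) ^ 2 * hζc
  have hwK : (r : ℂ) ^ (2 * (N + 1)) =
      ((r : ℂ) * ζ) ^ (N + 1) * ((r : ℂ) * conj ζ) ^ (N + 1) := by
    rw [← mul_pow, hww, pow_mul]
  have key : (1 - (r : ℂ) ^ 2) * (A * conj A) = 1 - (r : ℂ) ^ (2 * (N + 1)) + (S + conj S) := by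
    rw [hconjS, hSA, hwK, ← hww]
    have e1 : ((r : ℂ) * ζ) ^ (N + 1) = A * ((r : ℂ) * ζ - 1) + 1 := by rw [hgA]; ring
    have e2 : ((r : ℂ) * conj ζ) ^ (N + 1) = conj A * ((r : ℂ) * conj ζ - 1) + 1 := by
      rw [hgB]; ring
    rw [e1, e2]
    ring
  rw [Complex.mul_conj, Complex.normSq_eq_norm_sq, Complex.add_conj] at key
  exact_mod_cast key

/-- On the unit circle, `Re (rζ / (1 - rζ))` has an explicit trigonometric minorant. -/
theorem minorant_le_re_of_norm_eq_one (N : ℕ) {r : ℝ} (hr0 : 0 < r) (hr1 : r < 1) (ζ : ℂ)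
    (hζ : ‖ζ‖ = 1) :
    -(r ^ (N + 1) / (1 + r ^ (N + 1))) + (∑ n ∈ Finset.Icc 1 N,
        (((r ^ n - r ^ (2 * (N + 1) - n)) / (1 + r ^ (N + 1)) ^ 2 : ℝ) : ℂ) * ζ ^ n).re ≤
      ((r : ℂ) * ζ / (1 - (r : ℂ) * ζ)).re := by
  have h := one_sub_sq_mul_normSq_geom_sum N r ζ hζ
  set A := ∑ j ∈ Finset.range (N + 1), ((r : ℂ) * ζ) ^ j with hA
  set S := ∑ n ∈ Finset.Icc 1 N, ((r ^ n - r ^ (2 * (N + 1) - n) : ℝ) : ℂ) * ζ ^ n with hS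
  have hsum : ∑ n ∈ Finset.Icc 1 N,
      (((r ^ n - r ^ (2 * (N + 1) - n)) / (1 + r ^ (N + 1)) ^ 2 : ℝ) : ℂ) * ζ ^ n =
      S / (((1 + r ^ (N + 1)) ^ 2 : ℝ) : ℂ) := by
    rw [hS, Finset.sum_div]
    refine Finset.sum_congr rfl fun n _ => ?_
    push_cast
    ring
  rw [hsum, Complex.div_ofReal_re]
  have hwn : ‖(r : ℂ) * ζ‖ = r := by simp [hζ, abs_of_pos hr0]
  have hne : 1 - (r : ℂ) * ζ ≠ 0 := by
    intro h0
    rw [← sub_eq_zero.mp h0, norm_one] at hwn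
    exact hr1.ne hwn.symm
  have hd : 0 < ‖1 - (r : ℂ) * ζ‖ ^ 2 := by positivity
  have hre : ((r : ℂ) * ζ / (1 - (r : ℂ) * ζ)).re =
      ((1 - r ^ 2) / ‖1 - (r : ℂ) * ζ‖ ^ 2 - 1) / 2 := by
    have hw2 : ((r : ℂ) * ζ).re ^ 2 + ((r : ℂ) * ζ).im ^ 2 = r ^ 2 := by
      have h2 := congrArg (· ^ 2) hwn
      simp only [← Complex.normSq_eq_norm_sq, Complex.normSq_apply] at h2
      rw [← h2]
      ring
    rw [← Complex.normSq_eq_norm_sq] at hd ⊢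
    have hd' : Complex.normSq (1 - (r : ℂ) * ζ) = 1 - 2 * ((r : ℂ) * ζ).re + r ^ 2 := by
      rw [← hw2, Complex.normSq_apply]
      simp only [Complex.sub_re, Complex.sub_im, Complex.one_re, Complex.one_im]
      ring
    rw [Complex.div_re]
    generalize (r : ℂ) * ζ = w at *
    simp only [Complex.sub_re, Complex.sub_im, Complex.one_re, Complex.one_im]
    field_simp
    rw [hd']
    linear_combination (-2) * hw2
  have hgeom : ‖A‖ * ‖1 - (r : ℂ) * ζ‖ ≤ 1 + r ^ (N + 1) := by
    have hg : A * ((r : ℂ) * ζ - 1) = ((r : ℂ) * ζ) ^ (N + 1) - 1 := geom_sum_mul _ _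
    rw [norm_sub_rev, ← norm_mul, hg]
    refine (norm_sub_le _ _).trans ?_
    rw [norm_pow, hwn, norm_one, add_comm]
  have hq : 0 < 1 + r ^ (N + 1) := by positivity
  have hA2 : ‖A‖ ^ 2 / (1 + r ^ (N + 1)) ^ 2 ≤ 1 / ‖1 - (r : ℂ) * ζ‖ ^ 2 := by
    rw [div_le_div_iff₀ (by positivity) hd, one_mul, ← mul_pow]
    exact pow_le_pow_left₀ (by positivity) hgeom 2
  have hr2 : 0 ≤ 1 - r ^ 2 := by nlinarith
  have hfin := mul_le_mul_of_nonneg_left hA2 hr2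
  rw [hre]
  have hS2 : -(r ^ (N + 1) / (1 + r ^ (N + 1))) + S.re / (1 + r ^ (N + 1)) ^ 2 =
      ((1 - r ^ 2) * (‖A‖ ^ 2 / (1 + r ^ (N + 1)) ^ 2) - 1) / 2 := by
    rw [← mul_div_assoc, h, mul_comm 2 (N + 1), pow_mul]
    field_simp
    ring
  rw [hS2]
  have : (1 - r ^ 2) / ‖1 - (r : ℂ) * ζ‖ ^ 2 = (1 - r ^ 2) * (1 / ‖1 - (r : ℂ) * ζ‖ ^ 2) := by ring
  rw [this]
  linarith

/-- The minorant of `Re (rζ / (1 - rζ))` remains valid on the closed disk. -/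
theorem minorant_le_re_of_norm_le_one (N : ℕ) {r : ℝ} (hr0 : 0 < r) (hr1 : r < 1) (ζ : ℂ)
    (hζ : ‖ζ‖ ≤ 1) :
    -(r ^ (N + 1) / (1 + r ^ (N + 1))) + (∑ n ∈ Finset.Icc 1 N,
        (((r ^ n - r ^ (2 * (N + 1) - n)) / (1 + r ^ (N + 1)) ^ 2 : ℝ) : ℂ) * ζ ^ n).re ≤
      ((r : ℂ) * ζ / (1 - (r : ℂ) * ζ)).re := by
  set b : ℕ → ℝ := fun n => (r ^ n - r ^ (2 * (N + 1) - n)) / (1 + r ^ (N + 1)) ^ 2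
  have hne : ∀ x ∈ Metric.closedBall (0 : ℂ) 1, 1 - (r : ℂ) * x ≠ 0 := by
    intro x hx h0
    rw [mem_closedBall_zero_iff] at hx
    have h1 : ‖(r : ℂ) * x‖ = 1 := by rw [← sub_eq_zero.mp h0, norm_one]
    rw [norm_mul, Complex.norm_real, Real.norm_of_nonneg hr0.le] at h1
    nlinarith
  let f : ℂ → ℂ := fun x =>
    Complex.exp ((∑ n ∈ Finset.Icc 1 N, (b n : ℂ) * x ^ n) - (r : ℂ) * x / (1 - (r : ℂ) * x))
  have hf : DiffContOnCl ℂ f (Metric.ball 0 1) := by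
    refine DifferentiableOn.diffContOnCl ?_
    rw [closure_ball _ one_ne_zero]
    refine DifferentiableOn.cexp (DifferentiableOn.sub (by fun_prop) ?_)
    exact DifferentiableOn.div (by fun_prop) (by fun_prop) hne
  have hbd : ∀ x ∈ frontier (Metric.ball (0 : ℂ) 1),
      ‖f x‖ ≤ Real.exp (r ^ (N + 1) / (1 + r ^ (N + 1))) := by
    intro x hx
    rw [frontier_ball _ one_ne_zero, mem_sphere_zero_iff_norm] at hx
    have := minorant_le_re_of_norm_eq_one N hr0 hr1 x hx
    rw [Complex.norm_exp, Real.exp_le_exp, Complex.sub_re]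
    linarith
  have := Complex.norm_le_of_forall_mem_frontier_norm_le Metric.isBounded_ball hf hbd
    (z := ζ) (by rw [closure_ball _ one_ne_zero]; simpa using hζ)
  rw [Complex.norm_exp, Real.exp_le_exp, Complex.sub_re] at this
  linarith

/-- Lower bound for the sum of `Re (r ζ_m / (1 - r ζ_m))` by power sums. -/
theorem neg_power_sums_le_sum_re (M N : ℕ) {r : ℝ} (hr0 : 0 < r) (hr1 : r < 1) (ζ : Fin M → ℂ)
    (hζ : ∀ m, ‖ζ m‖ ≤ 1) :
    -(M * (r ^ (N + 1) / (1 + r ^ (N + 1)))) - ∑ n ∈ Finset.Icc 1 N, r ^ n * ‖∑ m, ζ m ^ n‖ ≤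
      ∑ m, ((r : ℂ) * ζ m / (1 - (r : ℂ) * ζ m)).re := by
  set b : ℕ → ℝ := fun n => (r ^ n - r ^ (2 * (N + 1) - n)) / (1 + r ^ (N + 1)) ^ 2 with hb
  have h := Finset.sum_le_sum fun m (_ : m ∈ Finset.univ) =>
    minorant_le_re_of_norm_le_one N hr0 hr1 (ζ m) (hζ m)
  refine le_trans ?_ h
  rw [Finset.sum_add_distrib, ← Complex.re_sum, Finset.sum_comm]
  simp only [← Finset.mul_sum, Finset.sum_const, Finset.card_univ, Fintype.card_fin, nsmul_eq_mul]
  have hnorm : ‖∑ n ∈ Finset.Icc 1 N, (b n : ℂ) * ∑ m, ζ m ^ n‖ ≤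
      ∑ n ∈ Finset.Icc 1 N, r ^ n * ‖∑ m, ζ m ^ n‖ := by
    refine (norm_sum_le _ _).trans (Finset.sum_le_sum fun n hn => ?_)
    rw [norm_mul, Complex.norm_real]
    refine mul_le_mul_of_nonneg_right ?_ (norm_nonneg _)
    simp only [Finset.mem_Icc] at hn
    have h1 : r ^ (2 * (N + 1) - n) ≤ r ^ n := pow_le_pow_of_le_one hr0.le hr1.le (by omega)
    have h2 : 0 < r ^ (2 * (N + 1) - n) := by positivity
    have h3 : 0 < r ^ (N + 1) := by positivity
    have h4 : 0 < r ^ n := by positivity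
    rw [Real.norm_of_nonneg (div_nonneg (by linarith) (by positivity)), div_le_iff₀ (by positivity)]
    nlinarith [mul_pos h4 h3, mul_pos h4 (mul_pos h3 h3)]
  have hre := (abs_le.mp (Complex.abs_re_le_norm
    (∑ n ∈ Finset.Icc 1 N, (b n : ℂ) * ∑ m, ζ m ^ n))).1
  linarith

theorem one_sub_real_mul_mem_slitPlane {r : ℝ} (hr0 : 0 < r) (hr1 : r < 1) {ζ : ℂ}
    (hζ : ‖ζ‖ ≤ 1) : 1 - (r : ℂ) * ζ ∈ Complex.slitPlane := by
  refine Or.inl ?_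
  have h1 : ((r : ℂ) * ζ).re ≤ r := by
    rw [Complex.re_ofReal_mul]
    nlinarith [(Complex.re_le_norm ζ).trans hζ]
  simp only [Complex.sub_re, Complex.one_re]
  linarith

theorem hasDerivAt_log_norm_one_sub {r : ℝ} (hr0 : 0 < r) (hr1 : r < 1) {ζ : ℂ}
    (hζ : ‖ζ‖ ≤ 1) :
    HasDerivAt (fun s : ℝ => Real.log ‖1 - (s : ℂ) * ζ‖) (-(ζ / (1 - (r : ℂ) * ζ)).re) r := by
  have h1 : HasDerivAt (fun s : ℝ => 1 - (s : ℂ) * ζ) (-ζ) r := by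
    simpa using ((Complex.ofRealCLM.hasDerivAt (x := r)).mul_const ζ).const_sub 1
  have h2 := h1.clog_real (one_sub_real_mul_mem_slitPlane hr0 hr1 hζ)
  have h3 := Complex.reCLM.hasFDerivAt.comp_hasDerivAt r h2
  simpa [Function.comp_def, Complex.log_re, neg_div] using h3

/-- The inequality at the point `1`. -/
theorem sum_log_norm_one_sub_le (M N : ℕ) (ζ : Fin M → ℂ) (hζ : ∀ m, ‖ζ m‖ ≤ 1)
    (hne : ∀ m, 1 - ζ m ≠ 0) :
    ∑ m, Real.log ‖1 - ζ m‖ ≤ Real.log 2 * M / (N + 1)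
        + ∑ n ∈ Finset.Icc 1 N, (1 / (n : ℝ)) * ‖∑ m, ζ m ^ n‖ := by
  let H : ℝ → ℝ := fun r => ∑ m, Real.log ‖1 - (r : ℂ) * ζ m‖ -
    (Real.log (1 + r ^ (N + 1)) * (M / (N + 1))
      + ∑ n ∈ Finset.Icc 1 N, (r ^ n / (n : ℝ)) * ‖∑ m, ζ m ^ n‖)
  have hcont : ContinuousOn H (Set.Icc 0 1) := by
    refine ContinuousOn.sub (continuousOn_finsetSum _ fun m _ => ?_)
      (ContinuousOn.add (ContinuousOn.mul (ContinuousOn.log (by fun_prop) ?_) (by fun_prop))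
        (by fun_prop))
    · refine ContinuousOn.log (by fun_prop) fun r hr => ?_
      rw [norm_ne_zero_iff]
      rcases hr.1.eq_or_lt with h0 | h0
      · simp [← h0]
      rcases hr.2.eq_or_lt with h1 | h1
      · simpa [h1] using hne m
      exact Complex.slitPlane_ne_zero (one_sub_real_mul_mem_slitPlane h0 h1 (hζ m))
    · intro r hr
      have := pow_nonneg hr.1 (N + 1)
      positivity
  have hanti : AntitoneOn H (Set.Icc 0 1) := by
    refine antitoneOn_of_hasDerivWithinAt_nonpos (f' := fun r =>
      ∑ m, -(ζ m / (1 - (r : ℂ) * ζ m)).re - ((N + 1) * r ^ N / (1 + r ^ (N + 1)) * (M / (N + 1))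
        + ∑ n ∈ Finset.Icc 1 N, r ^ (n - 1) * ‖∑ m, ζ m ^ n‖))
      (convex_Icc 0 1) hcont ?_ ?_
    · intro r hr
      rw [interior_Icc] at hr
      have hq : 1 + r ^ (N + 1) ≠ 0 := by
        have := pow_pos hr.1 (N + 1)
        positivity
      refine HasDerivAt.hasDerivWithinAt ?_
      refine HasDerivAt.sub (HasDerivAt.fun_sum fun m _ =>
        hasDerivAt_log_norm_one_sub hr.1 hr.2 (hζ m)) (HasDerivAt.add ?_
          (HasDerivAt.fun_sum fun n hn => ?_))
      · refine HasDerivAt.mul_const ?_ _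
        refine HasDerivAt.log ?_ hq
        simpa using (hasDerivAt_pow (N + 1) r).const_add 1
      · refine HasDerivAt.mul_const ?_ _
        have hn0 : (n : ℝ) ≠ 0 := by
          simp only [Finset.mem_Icc] at hn
          exact_mod_cast (by omega : n ≠ 0)
        simpa [hn0] using (hasDerivAt_pow n r).div_const (n : ℝ)
    · intro r hr
      rw [interior_Icc] at hr
      have h := neg_power_sums_le_sum_re M N hr.1 hr.2 ζ hζ
      have hq : 0 < 1 + r ^ (N + 1) := by
        have := pow_pos hr.1 (N + 1)
        positivity
      have e1 : ∑ m, ((r : ℂ) * ζ m / (1 - (r : ℂ) * ζ m)).re =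
          r * ∑ m, (ζ m / (1 - (r : ℂ) * ζ m)).re := by
        rw [Finset.mul_sum]
        refine Finset.sum_congr rfl fun m _ => ?_
        rw [mul_div_assoc, Complex.re_ofReal_mul]
      have e2 : ∑ n ∈ Finset.Icc 1 N, r ^ n * ‖∑ m, ζ m ^ n‖ =
          r * ∑ n ∈ Finset.Icc 1 N, r ^ (n - 1) * ‖∑ m, ζ m ^ n‖ := by
        rw [Finset.mul_sum]
        refine Finset.sum_congr rfl fun n hn => ?_
        simp only [Finset.mem_Icc] at hn
        rw [← mul_assoc, mul_pow_sub_one (by omega)]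
      have e3 : (M : ℝ) * (r ^ (N + 1) / (1 + r ^ (N + 1))) =
          r * ((N + 1) * r ^ N / (1 + r ^ (N + 1)) * (M / (N + 1))) := by
        field_simp
        ring
      rw [e1, e2, e3] at h
      rw [Finset.sum_neg_distrib]
      refine nonpos_of_mul_nonpos_right (a := r) ?_ hr.1
      linarith
  have h01 := hanti (Set.left_mem_Icc.mpr zero_le_one) (Set.right_mem_Icc.mpr zero_le_one)
    zero_le_one
  have hzero : H 0 = 0 := by
    simp only [H]
    rw [Finset.sum_eq_zero (s := Finset.Icc 1 N)]
    · simp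
    · intro n hn
      simp only [Finset.mem_Icc] at hn
      simp [zero_pow (by omega : n ≠ 0)]
  rw [hzero] at h01
  simp only [H, Complex.ofReal_one, one_mul, one_pow, one_add_one_eq_two] at h01
  rw [mul_div_assoc]
  linarith

/-- Carneiro–Vaaler Erdős–Turán type inequality: for `α_1, …, α_M` in the closed unit
disk and any positive integer `N`, the log-modulus of `∏_m (z - α_m)` on the closed unit
disk is at most `(log 2) M/(N+1) + ∑_{n=1}^N |∑_m α_m^n| / n`. -/
theorem stmt4 (M N : ℕ) (hN : 0 < N) (α : Fin M → ℂ) (hα : ∀ m, ‖α m‖ ≤ 1)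
    (z : ℂ) (hz : ‖z‖ ≤ 1) :
    Real.log ‖∏ m, (z - α m)‖ ≤
      Real.log 2 * M / (N + 1)
        + ∑ n ∈ Finset.Icc 1 N, (1 / (n : ℝ)) * ‖∑ m, α m ^ n‖ := by
  set R := Real.log 2 * M / (N + 1)
    + ∑ n ∈ Finset.Icc 1 N, (1 / (n : ℝ)) * ‖∑ m, α m ^ n‖ with hR
  have hR0 : 0 ≤ R := by
    have := Real.log_nonneg one_le_two
    positivity
  have hbd : ∀ x ∈ frontier (Metric.ball (0 : ℂ) 1), ‖∏ m, (x - α m)‖ ≤ Real.exp R := by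
    intro x hx
    rw [frontier_ball _ one_ne_zero, mem_sphere_zero_iff_norm] at hx
    by_cases h0 : ∃ m, x - α m = 0
    · obtain ⟨m, hm⟩ := h0
      rw [Finset.prod_eq_zero (Finset.mem_univ m) hm, norm_zero]
      positivity
    push Not at h0
    have hx0 : x ≠ 0 := by
      rintro rfl
      simp at hx
    have hfac (m : Fin M) : 1 - α m / x = (x - α m) / x := by field_simp
    have h := sum_log_norm_one_sub_le M N (fun m => α m / x)
      (fun m => by simpa [hx] using hα m)
      (fun m => by rw [hfac]; exact div_ne_zero (h0 m) hx0)
    simp only [hfac, norm_div, hx, div_one, div_pow, ← Finset.sum_div, norm_pow, one_pow] at h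
    rw [← Real.log_prod (fun m _ => norm_ne_zero_iff.mpr (h0 m)), ← norm_prod] at h
    rwa [← Real.log_le_iff_le_exp (norm_pos_iff.mpr (Finset.prod_ne_zero_iff.mpr fun m _ => h0 m))]
  have hz' := Complex.norm_le_of_forall_mem_frontier_norm_le (f := fun x => ∏ m, (x - α m))
    Metric.isBounded_ball (Differentiable.diffContOnCl (by fun_prop)) hbd
    (z := z) (by rw [closure_ball _ one_ne_zero]; simpa using hz)
  rcases (norm_nonneg (∏ m, (z - α m))).eq_or_lt with h0 | h0
  · rwa [← h0, Real.log_zero]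
  · exact (Real.log_le_iff_le_exp h0).mpr hz'
end

section
/- Suppose \theta_1,...,\theta_{d-2} \in \mathbb{R} satisfy |\sum_{j=1}^{d-2} e^{in\theta_j}| \leq q^{-n/2}(1+q^n) for all integers n \geq 1, where q \geq 2. Then for every positive integer N and all s = \sigma + it with \sigma \geq 1/2, \log|\prod_{j=1}^{d-2}(1 - e^{i(\theta_j - t\log q)} q^{1/2-\sigma})| \leq (\log 2)\frac{d-2}{N+1} + (\log 2) N + 2\frac{q^{N/2}}{N}. -/
section

open Finset

lemma geom_aux_one (z : ℂ) (ρ : ℝ) (N : ℕ) :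
    (1 - ρ * z) * ∑ i ∈ range N, z ^ (i + 1) * (ρ : ℂ) ^ i
      = z - z ^ (N + 1) * (ρ : ℂ) ^ N := by
  rw [mul_sum]
  have h := sum_range_sub' (fun i => z ^ (i + 1) * (ρ : ℂ) ^ i) N
  simp only [zero_add, pow_one, pow_zero, mul_one] at h
  rw [← h]
  exact sum_congr rfl fun i _ => by ring

lemma geom_aux_two (z : ℂ) (ρ : ℝ) (N : ℕ) :
    (ρ - z) * ∑ i ∈ range N, z ^ (i + 1) * (ρ : ℂ) ^ (2 * N - i)
      = z * (ρ : ℂ) ^ (2 * N + 1) - z ^ (N + 1) * (ρ : ℂ) ^ (N + 1) := by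
  rw [mul_sum]
  have h := sum_range_sub' (fun i => z ^ (i + 1) * (ρ : ℂ) ^ (2 * N + 1 - i)) N
  have e : 2 * N + 1 - N = N + 1 := by omega
  simp only [zero_add, pow_one, Nat.sub_zero, e] at h
  rw [← h]
  refine sum_congr rfl fun i hi => ?_
  have hi : i < N := mem_range.1 hi
  obtain ⟨k, hk⟩ : ∃ k, 2 * N = i + k := ⟨2 * N - i, by omega⟩
  have e1 : 2 * N - i = k := by omega
  have e2 : 2 * N + 1 - i = k + 1 := by omega
  have e3 : 2 * N + 1 - (i + 1) = k := by omega
  rw [e1, e2, e3]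
  ring

lemma sum_re_eq (z : ℂ) (ρ : ℝ) (N : ℕ) :
    ∑ i ∈ range N, (z ^ (i + 1)).re * (ρ ^ i - ρ ^ (2 * N - i))
      = (∑ i ∈ range N, z ^ (i + 1) * (ρ : ℂ) ^ i).re
        - (∑ i ∈ range N, z ^ (i + 1) * (ρ : ℂ) ^ (2 * N - i)).re := by
  rw [Complex.re_sum, Complex.re_sum, ← sum_sub_distrib]
  refine sum_congr rfl fun i _ => ?_
  rw [← Complex.ofReal_pow, ← Complex.ofReal_pow, Complex.re_mul_ofReal, Complex.re_mul_ofReal]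
  ring

lemma denom_mul_sum_re (z : ℂ) (hz : ‖z‖ = 1) (ρ : ℝ) (N : ℕ) :
    (1 - 2 * ρ * z.re + ρ ^ 2) * ∑ i ∈ range N, (z ^ (i + 1)).re * (ρ ^ i - ρ ^ (2 * N - i))
      = ρ ^ N * (1 + ρ ^ (N + 1)) * (1 - 2 * ρ * z.re + ρ ^ 2)
        - (ρ - z.re) * (1 + ρ ^ (N + 1)) ^ 2
        - (1 - ρ ^ 2) * ρ ^ N * (1 + (z ^ (N + 1)).re) := by
  have hA := geom_aux_one z ρ N
  have hB := geom_aux_two z ρ N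
  rw [sum_re_eq]
  set A := ∑ i ∈ range N, z ^ (i + 1) * (ρ : ℂ) ^ i
  set B := ∑ i ∈ range N, z ^ (i + 1) * (ρ : ℂ) ^ (2 * N - i)
  set Z := z ^ (N + 1)
  have hs : z.re ^ 2 + z.im ^ 2 = 1 := by
    have := Complex.sq_norm z
    rw [hz, Complex.normSq_apply] at this
    linarith
  rw [← Complex.ofReal_pow] at hA
  rw [← Complex.ofReal_pow, ← Complex.ofReal_pow] at hB
  have hA1 := congrArg Complex.re hA
  have hA2 := congrArg Complex.im hA
  have hB1 := congrArg Complex.re hB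
  have hB2 := congrArg Complex.im hB
  simp only [Complex.mul_re, Complex.mul_im, Complex.sub_re, Complex.sub_im, Complex.one_re,
    Complex.one_im, Complex.ofReal_re, Complex.ofReal_im] at hA1 hA2 hB1 hB2
  have e1 : ρ ^ (N + 1) = ρ * ρ ^ N := by ring
  have e2 : ρ ^ (2 * N + 1) = ρ * (ρ ^ N) ^ 2 := by ring
  rw [e1] at hB1 hB2 ⊢
  rw [e2] at hB1 hB2
  have hA3 : (1 - 2 * ρ * z.re + ρ ^ 2) * A.re
      = z.re - Z.re * ρ ^ N - ρ + ρ * ρ ^ N * (z.re * Z.re + z.im * Z.im) := by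
    linear_combination (1 - ρ * z.re) * hA1 - ρ * z.im * hA2 - (ρ ^ 2 * A.re + ρ) * hs
  have hB3 : (1 - 2 * ρ * z.re + ρ ^ 2) * B.re
      = ρ ^ 2 * (ρ ^ N) ^ 2 * z.re - ρ ^ 2 * ρ ^ N * Z.re - ρ * (ρ ^ N) ^ 2
        + ρ * ρ ^ N * (z.re * Z.re + z.im * Z.im) := by
    linear_combination (ρ - z.re) * hB1 - z.im * hB2 - (B.re + ρ * (ρ ^ N) ^ 2) * hs
  linear_combination hA3 - hB3

lemma denom_pos (z : ℂ) (hz : ‖z‖ = 1) (ρ : ℝ) (h0 : 0 ≤ ρ) (h1 : ρ < 1) :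
    0 < 1 - 2 * ρ * z.re + ρ ^ 2 := by
  have h : z.re ≤ 1 := hz ▸ Complex.re_le_norm z
  nlinarith [mul_le_mul_of_nonneg_left h h0, sq_pos_of_pos (sub_pos.2 h1)]

lemma norm_sq_eq (z : ℂ) (hz : ‖z‖ = 1) (ρ : ℝ) :
    ‖1 - z * ρ‖ ^ 2 = 1 - 2 * ρ * z.re + ρ ^ 2 := by
  have := Complex.sq_norm z
  rw [hz, Complex.normSq_apply] at this
  rw [Complex.sq_norm, Complex.normSq_apply]
  simp only [Complex.mul_re, Complex.mul_im, Complex.sub_re, Complex.sub_im, Complex.one_re,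
    Complex.one_im, Complex.ofReal_re, Complex.ofReal_im]
  linear_combination -ρ ^ 2 * this

/-- A trigonometric majorant for the radial derivative of `log ‖1 - ρ z‖`. -/
lemma radial_deriv_le (z : ℂ) (hz : ‖z‖ = 1) (ρ : ℝ) (h0 : 0 ≤ ρ) (h1 : ρ < 1) (N : ℕ) :
    (ρ - z.re) / (1 - 2 * ρ * z.re + ρ ^ 2)
      ≤ ρ ^ N / (1 + ρ ^ (N + 1))
        - (∑ i ∈ range N, (z ^ (i + 1)).re * (ρ ^ i - ρ ^ (2 * N - i)))
          / (1 + ρ ^ (N + 1)) ^ 2 := by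
  have hD := denom_pos z hz ρ h0 h1
  have key := denom_mul_sum_re z hz ρ N
  have hR : 0 < 1 + ρ ^ (N + 1) := by positivity
  have hX : 0 ≤ 1 + (z ^ (N + 1)).re := by
    have h := (abs_le.1 (Complex.abs_re_le_norm (z ^ (N + 1)))).1
    rw [norm_pow, hz, one_pow] at h
    linarith
  have hpos : 0 ≤ (1 - ρ ^ 2) * ρ ^ N * (1 + (z ^ (N + 1)).re) :=
    mul_nonneg (mul_nonneg (by nlinarith) (by positivity)) hX
  set T := ∑ i ∈ range N, (z ^ (i + 1)).re * (ρ ^ i - ρ ^ (2 * N - i))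
  have e : ρ ^ N / (1 + ρ ^ (N + 1)) - T / (1 + ρ ^ (N + 1)) ^ 2
      = (ρ ^ N * (1 + ρ ^ (N + 1)) - T) / (1 + ρ ^ (N + 1)) ^ 2 := by
    field_simp
  rw [e, div_le_div_iff₀ hD (by positivity)]
  nlinarith

/-- Summed form of the majorant, given bounds on the power sums. -/
lemma sum_radial_deriv_le {ι : Type*} [Fintype ι] (z : ι → ℂ) (hz : ∀ j, ‖z j‖ = 1) (N : ℕ)
    (C : ℕ → ℝ) (hC : ∀ i < N, ‖∑ j, z j ^ (i + 1)‖ ≤ C i) (ρ : ℝ) (h0 : 0 ≤ ρ) (h1 : ρ < 1) :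
    ∑ j, (ρ - (z j).re) / (1 - 2 * ρ * (z j).re + ρ ^ 2)
      ≤ Fintype.card ι * (ρ ^ N / (1 + ρ ^ (N + 1)))
        + ∑ i ∈ range N, C i * (ρ ^ i - ρ ^ (2 * N - i)) := by
  refine (sum_le_sum fun j _ => radial_deriv_le (z j) (hz j) ρ h0 h1 N).trans ?_
  rw [sum_sub_distrib, sum_const, card_univ, nsmul_eq_mul, sub_eq_add_neg]
  gcongr
  rw [← sum_div, sum_comm, neg_le_iff_add_nonneg, sum_div, ← sum_add_distrib]
  refine sum_nonneg fun i hi => ?_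
  have hi : i < N := mem_range.1 hi
  rw [← sum_mul, ← Complex.re_sum]
  have hre := (abs_le.1 ((Complex.abs_re_le_norm _).trans (hC i hi))).1
  have hC0 := (norm_nonneg _).trans (hC i hi)
  have hd : 0 ≤ ρ ^ i - ρ ^ (2 * N - i) :=
    sub_nonneg.2 (pow_le_pow_of_le_one h0 h1.le (by omega))
  have hR : 1 ≤ (1 + ρ ^ (N + 1)) ^ 2 := one_le_pow₀ (by linarith [pow_nonneg h0 (N + 1)])
  have hle : C i / (1 + ρ ^ (N + 1)) ^ 2 ≤ C i := div_le_self hC0 hR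
  have hle2 := div_le_div_of_nonneg_right hre (by positivity : 0 ≤ (1 + ρ ^ (N + 1)) ^ 2)
  rw [mul_div_right_comm, ← add_mul]
  refine mul_nonneg ?_ hd
  rw [neg_div] at hle2
  linarith

/-- Degree-`N` bound for the logarithm of a product over points of the unit circle. -/
lemma log_norm_prod_le {ι : Type*} [Fintype ι] (z : ι → ℂ) (hz : ∀ j, ‖z j‖ = 1) (N : ℕ)
    (C : ℕ → ℝ) (hC : ∀ i < N, ‖∑ j, z j ^ (i + 1)‖ ≤ C i) (r : ℝ) (h0 : 0 ≤ r) (h1 : r ≤ 1) :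
    Real.log ‖∏ j, (1 - z j * r)‖
      ≤ Real.log 2 * Fintype.card ι / (N + 1)
        + ∑ i ∈ range N, C i * (1 / ((i : ℝ) + 1) - 1 / (2 * N + 1 - i)) := by
  set G : ℝ → ℝ := fun ρ => Fintype.card ι * (Real.log (1 + ρ ^ (N + 1)) / (N + 1))
    + ∑ i ∈ range N, C i * (ρ ^ (i + 1) / ((i : ℝ) + 1) - ρ ^ (2 * N - i + 1) / (2 * N + 1 - i))
    with hGdef
  have hG : ∀ ρ : ℝ, 0 ≤ ρ → HasDerivAt G (Fintype.card ι * (ρ ^ N / (1 + ρ ^ (N + 1)))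
        + ∑ i ∈ range N, C i * (ρ ^ i - ρ ^ (2 * N - i))) ρ := by
    intro ρ hρ
    have hR : 1 + ρ ^ (N + 1) ≠ 0 := by positivity
    refine HasDerivAt.add (HasDerivAt.const_mul _ ?_) (HasDerivAt.fun_sum fun i hi => ?_)
    · convert (((hasDerivAt_pow (N + 1) ρ).const_add 1).log hR).div_const ((N : ℝ) + 1) using 1
      push_cast
      field_simp
    · have hi : i < N := mem_range.1 hi
      have hc : ((2 * N - i : ℕ) : ℝ) = 2 * N - i := by
        rw [Nat.cast_sub (by omega)]; push_cast; ring
      have hd : (2 * N + 1 - i : ℝ) ≠ 0 := by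
        have : (i : ℝ) < N := by exact_mod_cast hi
        have : (0 : ℝ) ≤ i := i.cast_nonneg
        linarith
      refine HasDerivAt.const_mul _ ?_
      refine (((hasDerivAt_pow (i + 1) ρ).div_const ((i : ℝ) + 1)).sub
        ((hasDerivAt_pow (2 * N - i + 1) ρ).div_const (2 * N + 1 - i : ℝ))).congr_deriv ?_
      rw [Nat.add_sub_cancel, Nat.add_sub_cancel]
      push_cast
      rw [hc]
      have e : (2 * N - i + 1 : ℝ) = 2 * N + 1 - i := by ring
      rw [e]
      field_simp
  have hGmono : MonotoneOn G (Set.Icc 0 1) := by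
    refine monotoneOn_of_hasDerivWithinAt_nonneg (convex_Icc 0 1)
      (fun ρ hρ => (hG ρ hρ.1).continuousAt.continuousWithinAt)
      (fun ρ hρ => (hG ρ (interior_subset hρ).1).hasDerivWithinAt) ?_
    intro ρ hρ
    have hρ := interior_subset hρ
    refine add_nonneg (mul_nonneg (Nat.cast_nonneg _)
      (div_nonneg (pow_nonneg hρ.1 _) (add_nonneg zero_le_one (pow_nonneg hρ.1 _))))
      (sum_nonneg fun i hi => ?_)
    have hi : i < N := mem_range.1 hi
    exact mul_nonneg ((norm_nonneg _).trans (hC i hi))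
      (sub_nonneg.2 (pow_le_pow_of_le_one hρ.1 hρ.2 (by omega)))
  have hG0 : G 0 = 0 := by simp [hGdef]
  have hG1 : G 1 = Real.log 2 * Fintype.card ι / (N + 1)
        + ∑ i ∈ range N, C i * (1 / ((i : ℝ) + 1) - 1 / (2 * N + 1 - i)) := by
    simp only [hGdef, one_pow]
    norm_num
    ring
  rw [← hG1]
  have hr1 : G r ≤ G 1 := hGmono ⟨h0, h1⟩ ⟨zero_le_one, le_rfl⟩ h1
  by_cases hprod : ∏ j, (1 - z j * (r : ℂ)) = 0
  · rw [hprod, norm_zero, Real.log_zero, ← hG0]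
    exact hGmono ⟨le_rfl, zero_le_one⟩ ⟨zero_le_one, le_rfl⟩ zero_le_one
  refine le_trans ?_ hr1
  rw [prod_eq_zero_iff] at hprod
  push Not at hprod
  have hD : ∀ ρ ∈ Set.Icc 0 r, ∀ j, 0 < 1 - 2 * ρ * (z j).re + ρ ^ 2 := by
    intro ρ hρ j
    rcases hρ.2.eq_or_lt with h | h
    · rw [h, ← norm_sq_eq (z j) (hz j)]
      have := norm_pos_iff.2 (hprod j (mem_univ j))
      positivity
    · exact denom_pos (z j) (hz j) ρ hρ.1 (h.trans_le h1)
  set F : ℝ → ℝ := fun ρ => ∑ j, Real.log (1 - 2 * ρ * (z j).re + ρ ^ 2) / 2 with hFdef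
  have hF : ∀ ρ ∈ Set.Icc 0 r, HasDerivAt F
      (∑ j, (ρ - (z j).re) / (1 - 2 * ρ * (z j).re + ρ ^ 2)) ρ := by
    intro ρ hρ
    refine HasDerivAt.fun_sum fun j _ => ?_
    have hpoly : HasDerivAt (fun ρ : ℝ => 1 - 2 * ρ * (z j).re + ρ ^ 2)
        (2 * (ρ - (z j).re)) ρ := by
      refine (((((hasDerivAt_id ρ).const_mul 2).mul_const (z j).re).const_sub 1).add
        (hasDerivAt_pow 2 ρ)).congr_deriv ?_
      norm_num
      ring
    refine ((hpoly.log (hD ρ hρ j).ne').div_const 2).congr_deriv ?_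
    ring
  have hmono : MonotoneOn (fun ρ => G ρ - F ρ) (Set.Icc 0 r) := by
    refine monotoneOn_of_hasDerivWithinAt_nonneg (convex_Icc 0 r)
      (fun ρ hρ => ((hG ρ hρ.1).sub (hF ρ hρ)).continuousAt.continuousWithinAt)
      (fun ρ hρ => ((hG ρ (interior_subset hρ).1).sub
        (hF ρ (interior_subset hρ))).hasDerivWithinAt) ?_
    intro ρ hρ
    rw [interior_Icc] at hρ
    exact sub_nonneg.2 (sum_radial_deriv_le z hz N C hC ρ hρ.1.le (hρ.2.trans_le h1))
  have hF0 : F 0 = 0 := by simp [hFdef]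
  have hFr : F r = Real.log ‖∏ j, (1 - z j * (r : ℂ))‖ := by
    rw [norm_prod, Real.log_prod fun j hj => norm_ne_zero_iff.2 (hprod j hj)]
    refine sum_congr rfl fun j _ => ?_
    rw [← norm_sq_eq (z j) (hz j), Real.log_pow]
    push_cast
    ring
  have := hmono ⟨le_rfl, h0⟩ ⟨h0, le_rfl⟩ h0
  simp only [hG0, hF0, sub_zero] at this
  linarith

/-- Power-sum bounds `xⁿ + x⁻ⁿ` against the weights `1 / n - 1 / (2 N + 2 - n)`. -/
noncomputable def weightedSum (x : ℝ) (N : ℕ) : ℝ :=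
  ∑ i ∈ range N, (x ^ (i + 1) + (x ^ (i + 1))⁻¹) * (1 / ((i : ℝ) + 1) - 1 / (2 * N + 1 - i))

lemma sum_pow_add_inv_le {x : ℝ} (hx : 1 < x) (N : ℕ) :
    ∑ i ∈ range N, (x ^ (i + 1) + (x ^ (i + 1))⁻¹) ≤ x ^ (N + 1) / (x - 1) := by
  have h : ∑ i ∈ range N, (x ^ (i + 1) + (x ^ (i + 1))⁻¹)
      ≤ (x ^ (N + 1) - (x ^ N)⁻¹) / (x - 1) := by
    induction N with
    | zero =>
      have : (1:ℝ) ≤ x := hx.le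
      have : 0 < x - 1 := by linarith
      simp only [range_zero, sum_empty, zero_add, pow_one, pow_zero, inv_one]
      positivity
    | succ N ih =>
      rw [sum_range_succ]
      refine (add_le_add_left ih _).trans (le_of_eq ?_)
      have : x - 1 ≠ 0 := by linarith
      have : x ≠ 0 := by linarith
      field_simp
      ring
  refine h.trans ?_
  have : 0 < x - 1 := by linarith
  gcongr
  have : 0 ≤ (x ^ N)⁻¹ := by positivity
  linarith

lemma weightedSum_succ_le {x : ℝ} (hx : 1 < x) (N : ℕ) :
    weightedSum x (N + 1) ≤ weightedSum x N
      + 2 / (((N : ℝ) + 2) * (N + 4)) * (x ^ (N + 1) / (x - 1))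
      + (x ^ (N + 1) + (x ^ (N + 1))⁻¹) * (1 / ((N : ℝ) + 1) - 1 / (N + 3)) := by
  have hx0 : 0 < x := by linarith
  unfold weightedSum
  rw [sum_range_succ]
  have e : 2 * ((N + 1 : ℕ) : ℝ) + 1 - N = N + 3 := by push_cast; ring
  rw [e]
  gcongr
  refine le_trans ?_ (add_le_add_right (mul_le_mul_of_nonneg_left (sum_pow_add_inv_le hx N)
    (by positivity)) _)
  rw [mul_sum, ← sum_add_distrib]
  refine sum_le_sum fun i hi => ?_
  have hi : ((i : ℝ) + 1) ≤ N := by exact_mod_cast mem_range.1 hi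
  rw [mul_comm (2 / _), ← mul_add]
  gcongr
  push_cast
  have h1 : (0 : ℝ) < 2 * N + 1 - i := by linarith [(Nat.cast_nonneg i : (0:ℝ) ≤ i)]
  have h2 : (0 : ℝ) < 2 * (N + 1) + 1 - i := by linarith
  have e2 : 1 / (2 * (N : ℝ) + 1 - i) - 1 / (2 * (N + 1) + 1 - i)
      = 2 / ((2 * N + 1 - i) * (2 * (N + 1) + 1 - i)) := by
    field_simp
    ring
  have h3 : 2 / ((2 * (N : ℝ) + 1 - i) * (2 * (N + 1) + 1 - i)) ≤ 2 / (((N : ℝ) + 2) * (N + 4)) := by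
    gcongr <;> linarith
  linarith

/-- Weighted arithmetic-geometric mean inequality. -/
lemma succ_mul_pow_mul_le {x y : ℝ} (hx : 0 ≤ x) (hy : 0 ≤ y) (N : ℕ) :
    (N + 1) * x ^ N * y ≤ N * x ^ (N + 1) + y ^ (N + 1) := by
  induction N with
  | zero => simp
  | succ N ih =>
    have h : 0 ≤ (x ^ (N + 1) - y ^ (N + 1)) * (x - y) := by
      rcases le_total x y with h | h
      · exact mul_nonneg_of_nonpos_of_nonpos (sub_nonpos.2 (pow_le_pow_left₀ hx h _))
          (sub_nonpos.2 h)
      · exact mul_nonneg (sub_nonneg.2 (pow_le_pow_left₀ hy h _)) (sub_nonneg.2 h)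
    have := mul_le_mul_of_nonneg_left ih hx
    push_cast
    linear_combination this + h

lemma growth_bound {x : ℝ} (hx : 1414 / 1000 ≤ x) {N : ℕ} (hN : 4 ≤ N) :
    x ^ N * (2 / N + 6832 / 1000 / (((N : ℝ) + 2) * (N + 4)))
      ≤ x ^ (N + 1) * (1 / ((N : ℝ) + 1) + 1 / (N + 3)) + 67 / 100 := by
  have hx0 : 0 ≤ x := by linarith
  rcases le_or_gt 11 N with h | h
  · obtain ⟨m, rfl⟩ : ∃ m, N = m + 11 := ⟨N - 11, by omega⟩
    have hm : (0 : ℝ) ≤ m := Nat.cast_nonneg m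
    have key : 2 / ((m + 11 : ℕ) : ℝ) + 6832 / 1000 / ((((m + 11 : ℕ) : ℝ) + 2) * ((m + 11 : ℕ) + 4))
        ≤ 1414 / 1000 * (1 / (((m + 11 : ℕ) : ℝ) + 1) + 1 / ((m + 11 : ℕ) + 3)) := by
      push_cast
      rw [← sub_nonneg]
      have : 1414 / 1000 * (1 / ((m : ℝ) + 11 + 1) + 1 / (m + 11 + 3))
          - (2 / ((m : ℝ) + 11) + 6832 / 1000 / (((m : ℝ) + 11 + 2) * (m + 11 + 4)))
          = (1414 / 1000 * (2 * m + 26) * (m + 11) * (m + 13) * (m + 15)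
            - (m + 12) * (m + 14) * (2 * (m + 13) * (m + 15) + 6832 / 1000 * (m + 11)))
            / ((m + 11) * (m + 12) * (m + 13) * (m + 14) * (m + 15)) := by
        field_simp
        ring
      rw [this]
      refine div_nonneg ?_ (by positivity)
      ring_nf
      positivity
    have h2 := mul_le_mul_of_nonneg_left key (pow_nonneg hx0 (m + 11))
    have h3 : x ^ (m + 11) * (1414 / 1000 * (1 / (((m + 11 : ℕ) : ℝ) + 1) + 1 / ((m + 11 : ℕ) + 3)))
        ≤ x ^ (m + 11) * (x * (1 / (((m + 11 : ℕ) : ℝ) + 1) + 1 / ((m + 11 : ℕ) + 3))) := by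
      gcongr
    have e : x ^ (m + 11 + 1) = x ^ (m + 11) * x := pow_succ _ _
    rw [e, mul_assoc]
    linarith
  · interval_cases N
    · have := succ_mul_pow_mul_le hx0 (by norm_num : (0 : ℝ) ≤ 1500 / 1000) 4
      norm_num at this ⊢
      linarith [pow_nonneg hx0 4]
    · have := succ_mul_pow_mul_le hx0 (by norm_num : (0 : ℝ) ≤ 1454 / 1000) 5
      norm_num at this ⊢
      linarith [pow_nonneg hx0 5]
    · have := succ_mul_pow_mul_le hx0 (by norm_num : (0 : ℝ) ≤ 1420 / 1000) 6
      norm_num at this ⊢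
      linarith [pow_nonneg hx0 6]
    · have := succ_mul_pow_mul_le hx0 (by norm_num : (0 : ℝ) ≤ 1400 / 1000) 7
      norm_num at this ⊢
      linarith [pow_nonneg hx0 7]
    · have := succ_mul_pow_mul_le hx0 (by norm_num : (0 : ℝ) ≤ 1380 / 1000) 8
      norm_num at this ⊢
      linarith [pow_nonneg hx0 8]
    · have := succ_mul_pow_mul_le hx0 (by norm_num : (0 : ℝ) ≤ 1360 / 1000) 9
      norm_num at this ⊢
      linarith [pow_nonneg hx0 9]
    · have := succ_mul_pow_mul_le hx0 (by norm_num : (0 : ℝ) ≤ 1340 / 1000) 10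
      norm_num at this ⊢
      linarith [pow_nonneg hx0 10]

lemma weightedSum_le {x : ℝ} (hx : 1 < x) (hx2 : 2 ≤ x ^ 2) {N : ℕ} (hN : 1 ≤ N) :
    weightedSum x N ≤ Real.log 2 * N + 2 * x ^ N / N := by
  have hlog := Real.log_two_gt_d9
  have hx0 : 0 < x := by linarith
  have hx1 : 1414 / 1000 ≤ x := by nlinarith
  have hi1 : x⁻¹ ≤ 3 / 4 := by
    rw [inv_le_comm₀ hx0 (by norm_num)]
    norm_num
    linarith
  have hi2 : (x ^ 2)⁻¹ ≤ 1 / 2 := by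
    rw [inv_le_comm₀ (by positivity) (by norm_num)]
    norm_num
    linarith
  have hx3 : 2 ≤ x ^ 3 := by nlinarith
  have hi3 : (x ^ 3)⁻¹ ≤ 1 / 2 := by
    rw [inv_le_comm₀ (by positivity) (by norm_num)]
    norm_num
    linarith
  have hi4 : (x ^ 4)⁻¹ ≤ 1 / 4 := by
    rw [inv_le_comm₀ (by positivity) (by norm_num)]
    nlinarith
  rcases le_or_gt 4 N with h4 | h4
  · induction N, h4 using Nat.le_induction with
    | base =>
      norm_num [weightedSum, sum_range_succ]
      nlinarith [sq_nonneg (x ^ 2 - 2), sq_nonneg (x - 3 / 2), sq_nonneg (x ^ 2 - x)]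
    | succ N h ih =>
      have hN0 : (0 : ℝ) < N := by exact_mod_cast (by omega : 0 < N)
      have h1 := weightedSum_succ_le hx N
      have h2 := ih (by omega)
      have h3 := growth_bound hx1 h
      have h4 : (x ^ (N + 1))⁻¹ * (1 / ((N : ℝ) + 1) - 1 / (N + 3)) ≤ 2 / 100 := by
        have hx4 : x ^ 4 ≤ x ^ (N + 1) := pow_le_pow_right₀ hx.le (by omega)
        have hinv : (x ^ (N + 1))⁻¹ ≤ 1 / 4 :=
          (inv_anti₀ (by positivity) hx4).trans hi4
        have hN4 : (4 : ℝ) ≤ N := by exact_mod_cast h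
        have hw : 1 / ((N : ℝ) + 1) - 1 / (N + 3) ≤ 2 / 35 := by
          have e : 1 / ((N : ℝ) + 1) - 1 / (N + 3) = 2 / ((N + 1) * (N + 3)) := by
            field_simp
            ring
          rw [e, div_le_div_iff₀ (by positivity) (by norm_num)]
          nlinarith
        have hw0 : 0 ≤ 1 / ((N : ℝ) + 1) - 1 / (N + 3) :=
          sub_nonneg.2 (one_div_le_one_div_of_le (by positivity) (by linarith))
        refine (mul_le_mul hinv hw hw0 (by norm_num)).trans (by norm_num)
      have h5 : 2 / (((N : ℝ) + 2) * (N + 4)) * (x ^ (N + 1) / (x - 1))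
          ≤ x ^ N * (6832 / 1000 / (((N : ℝ) + 2) * (N + 4))) := by
        have : x / (x - 1) ≤ 3416 / 1000 := by
          rw [div_le_iff₀ (by linarith)]
          linarith
        have e : 2 / (((N : ℝ) + 2) * (N + 4)) * (x ^ (N + 1) / (x - 1))
            = x ^ N * (2 / (((N : ℝ) + 2) * (N + 4)) * (x / (x - 1))) := by
          rw [pow_succ]; ring
        rw [e]
        gcongr
        refine (mul_le_mul_of_nonneg_left this (by positivity)).trans (le_of_eq ?_)
        ring
      push_cast
      have e1 : 2 * x ^ (N + 1) / ((N : ℝ) + 1) = 2 * (x ^ (N + 1) * (1 / ((N : ℝ) + 1))) := by ring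
      have e2 : 2 * x ^ N / (N : ℝ) = x ^ N * (2 / N) := by ring
      rw [e1]
      rw [e2] at h2
      linarith
  · interval_cases N
    · norm_num [weightedSum]
      linarith
    · norm_num [weightedSum, sum_range_succ]
      nlinarith
    · norm_num [weightedSum, sum_range_succ]
      nlinarith [mul_nonneg hx0.le (sq_nonneg (x - 3 / 2)), sq_nonneg (x - 3 / 2)]

end


/-- Explicit bound towards Lindelöf: if the eigenangle power sums satisfy
`|∑_j e^{inθ_j}| ≤ q^{-n/2}(1+q^n)` for all `n ≥ 1`, then for every positive `N` and
`s = σ + it` with `σ ≥ 1/2`,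
`log |∏_j (1 - e^{i(θ_j - t log q)} q^{1/2-σ})|
  ≤ (log 2)(d-2)/(N+1) + (log 2) N + 2 q^{N/2}/N`. -/
theorem stmt5 (q : ℝ) (hq : 2 ≤ q) (d : ℕ) (θ : Fin (d - 2) → ℝ)
    (htr : ∀ n : ℕ, 1 ≤ n →
      ‖∑ j, Complex.exp ((n : ℂ) * (θ j : ℂ) * Complex.I)‖
        ≤ q ^ (-(n : ℝ) / 2) * (1 + q ^ (n : ℝ)))
    (N : ℕ) (hN : 0 < N) (σ t : ℝ) (hσ : 1 / 2 ≤ σ) :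
    Real.log ‖∏ j, (1 - Complex.exp (((θ j - t * Real.log q : ℝ) : ℂ) * Complex.I)
        * ((q ^ ((1 : ℝ) / 2 - σ) : ℝ) : ℂ))‖
      ≤ Real.log 2 * ((d - 2 : ℕ) : ℝ) / (N + 1)
        + Real.log 2 * N + 2 * q ^ ((N : ℝ) / 2) / N := by
  have hq0 : 0 < q := by linarith
  have hx2 : √q ^ 2 = q := Real.sq_sqrt hq0.le
  have hx : 1 < √q := Real.lt_sqrt_of_sq_lt (by linarith)
  have hx0 : 0 < √q := by linarith
  have hhalf : ∀ n : ℕ, q ^ ((n : ℝ) / 2) = √q ^ n := by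
    intro n
    rw [Real.sqrt_eq_rpow, ← Real.rpow_mul_natCast hq0.le]
    congr 1
    ring
  have hr1 : q ^ ((1 : ℝ) / 2 - σ) ≤ 1 :=
    Real.rpow_le_one_of_one_le_of_nonpos (by linarith) (by linarith)
  have hbound := log_norm_prod_le
    (fun j => Complex.exp (((θ j - t * Real.log q : ℝ) : ℂ) * Complex.I))
    (fun j => Complex.norm_exp_ofReal_mul_I _) N
    (fun i => √q ^ (i + 1) + (√q ^ (i + 1))⁻¹) ?_ _ (Real.rpow_nonneg hq0.le _) hr1
  · have hsum := weightedSum_le hx (by rw [hx2]; exact hq) hN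
    rw [Fintype.card_fin] at hbound
    rw [hhalf]
    unfold weightedSum at hsum
    linarith
  · intro i _
    have htwist : ∑ j, Complex.exp (((θ j - t * Real.log q : ℝ) : ℂ) * Complex.I) ^ (i + 1)
        = Complex.exp (((-((i + 1 : ℕ) * (t * Real.log q)) : ℝ) : ℂ) * Complex.I)
          * ∑ j, Complex.exp (((i + 1 : ℕ) : ℂ) * (θ j : ℂ) * Complex.I) := by
      rw [Finset.mul_sum]
      refine Finset.sum_congr rfl fun j _ => ?_
      rw [← Complex.exp_nat_mul, ← Complex.exp_add]
      congr 1
      push_cast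
      ring
    rw [htwist, norm_mul, Complex.norm_exp_ofReal_mul_I, one_mul]
    refine (htr (i + 1) (by omega)).trans (le_of_eq ?_)
    rw [neg_div, Real.rpow_neg hq0.le, hhalf, Real.rpow_natCast]
    have e : q ^ (i + 1) = √q ^ (i + 1) * √q ^ (i + 1) := by
      rw [← mul_pow, ← sq, hx2]
    rw [e]
    field_simp
    ring
end

section
/- Under the hypotheses above (|\sum_{j=1}^{d-2} e^{in\theta_j}| \leq q^{-n/2}(1+q^n) for all n \geq 1, with q \geq 2 fixed), for every \varepsilon > 0 there exists D such that for all d \geq D, \log|\prod_{j=1}^{d-2}(1 - e^{i\phi_j} r)| \leq (\frac{\log 2}{2} + \varepsilon)\frac{d}{\log_q d} uniformly over all r \in [0,1] and all common rotations \phi_j = \theta_j - c. -/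
/-- The function `x ↦ log ‖1 - z x‖` has the expected derivative on the real line. -/
theorem hasDerivAt_log_norm_one_sub_s6 {z : ℂ} (hz : ‖z‖ = 1) {s : ℝ} (h : 1 - z * (s : ℂ) ≠ 0) :
    HasDerivAt (fun x : ℝ => Real.log ‖1 - z * (x : ℂ)‖)
      ((s - z.re) / Complex.normSq (1 - z * (s : ℂ))) s := by
  have hsq : z.re * z.re + z.im * z.im = 1 := by
    rw [← Complex.normSq_apply, Complex.normSq_eq_norm_sq, hz, one_pow]
  have hN : ∀ x : ℝ, Complex.normSq (1 - z * (x : ℂ)) = 1 - 2 * x * z.re + x ^ 2 := by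
    intro x
    simp [Complex.normSq_apply]
    linear_combination x ^ 2 * hsq
  have hfun : (fun x : ℝ => Real.log ‖1 - z * (x : ℂ)‖)
      = fun x : ℝ => Real.log (1 - 2 * x * z.re + x ^ 2) / 2 := by
    funext x
    rw [← hN, Complex.normSq_eq_norm_sq, Real.log_pow]
    push_cast
    ring
  have hne : 1 - 2 * s * z.re + s ^ 2 ≠ 0 := by
    rw [← hN]
    exact fun h0 => h (Complex.normSq_eq_zero.1 h0)
  rw [hfun, hN]
  have hd : HasDerivAt (fun x : ℝ => 1 - 2 * x * z.re + x ^ 2) (-2 * z.re + 2 * s) s := by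
    have h1 : HasDerivAt (fun x : ℝ => 2 * x * z.re) (2 * 1 * z.re) s :=
      ((hasDerivAt_id s).const_mul 2).mul_const z.re
    have h2 : HasDerivAt (fun x : ℝ => x ^ 2) (2 * s) s := by
      simpa using hasDerivAt_pow 2 s
    exact ((h1.const_sub 1).add h2).congr_deriv (by ring)
  refine ((hd.log hne).div_const 2).congr_deriv ?_
  field_simp
  ring

/-- The Poisson kernel at `s` is minorized by a multiple of a squared geometric sum of length `M`,
written for the derivative of `log ‖1 - z s‖`. -/
theorem sub_re_div_normSq_le {z : ℂ} (hz : ‖z‖ = 1) {s : ℝ} (hs0 : 0 < s) (hs1 : s < 1) (M : ℕ) :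
    (s - z.re) / Complex.normSq (1 - z * (s : ℂ)) ≤
      (1 - (1 - s ^ 2) * Complex.normSq (∑ k ∈ Finset.range M, (z * (s : ℂ)) ^ k)
        / (1 + s ^ M) ^ 2) / (2 * s) := by
  have hsq : z.re * z.re + z.im * z.im = 1 := by
    rw [← Complex.normSq_apply, Complex.normSq_eq_norm_sq, hz, one_pow]
  have hN : Complex.normSq (1 - z * (s : ℂ)) = 1 - 2 * s * z.re + s ^ 2 := by
    simp [Complex.normSq_apply]
    linear_combination s ^ 2 * hsq
  have hws : ‖z * (s : ℂ)‖ = s := by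
    rw [norm_mul, hz, one_mul, Complex.norm_real, Real.norm_of_nonneg hs0.le]
  have hne : 1 - z * (s : ℂ) ≠ 0 := by
    intro h
    rw [← sub_eq_zero.1 h, norm_one] at hws
    exact hs1.ne' hws
  have hA : 0 < Complex.normSq (1 - z * (s : ℂ)) := Complex.normSq_pos.2 hne
  have hS : Complex.normSq (∑ k ∈ Finset.range M, (z * (s : ℂ)) ^ k)
      * Complex.normSq (1 - z * (s : ℂ)) ≤ (1 + s ^ M) ^ 2 := by
    rw [← map_mul, geom_sum_mul_neg, Complex.normSq_eq_norm_sq]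
    have : ‖1 - (z * (s : ℂ)) ^ M‖ ≤ 1 + s ^ M := by
      refine (norm_sub_le _ _).trans ?_
      rw [norm_one, norm_pow, hws]
    gcongr
  have hle : (1 - s ^ 2) * Complex.normSq (∑ k ∈ Finset.range M, (z * (s : ℂ)) ^ k)
      / (1 + s ^ M) ^ 2 ≤ (1 - s ^ 2) / Complex.normSq (1 - z * (s : ℂ)) := by
    rw [div_le_div_iff₀ (by positivity) hA, mul_assoc]
    exact mul_le_mul_of_nonneg_left hS (by nlinarith)
  have heq : (s - z.re) / Complex.normSq (1 - z * (s : ℂ))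
      = (1 - (1 - s ^ 2) / Complex.normSq (1 - z * (s : ℂ))) / (2 * s) := by
    have hA' := hA.ne'
    field_simp
    rw [hN]
    ring
  rw [heq]
  gcongr

/-- Mixed power sums of points of the unit circle reduce to plain power sums. -/
theorem norm_sum_pow_mul_conj_pow_le {ι : Type*} [Fintype ι] {z : ι → ℂ} (hz : ∀ j, ‖z j‖ = 1)
    {M : ℕ} {B : ℝ} (hB : ∀ n : ℕ, 1 ≤ n → n < M → ‖∑ j, z j ^ n‖ ≤ B)
    {k l : ℕ} (hk : k < M) (hl : l < M) (hkl : k ≠ l) :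
    ‖∑ j, z j ^ k * (starRingEnd ℂ (z j)) ^ l‖ ≤ B := by
  have hzc : ∀ j, z j * starRingEnd ℂ (z j) = 1 := fun j => by
    rw [Complex.mul_conj, Complex.normSq_eq_norm_sq, hz j]; simp
  rcases lt_or_gt_of_ne hkl with h | h
  · obtain ⟨n, rfl⟩ := Nat.exists_eq_add_of_lt h
    have : ∑ j, z j ^ k * (starRingEnd ℂ (z j)) ^ (k + n + 1)
        = starRingEnd ℂ (∑ j, z j ^ (n + 1)) := by
      rw [map_sum]
      refine Finset.sum_congr rfl fun j _ => ?_
      rw [add_assoc, pow_add, ← mul_assoc, ← mul_pow, hzc, one_pow, one_mul, map_pow]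
    rw [this, Complex.norm_conj]
    exact hB _ (by omega) (by omega)
  · obtain ⟨n, rfl⟩ := Nat.exists_eq_add_of_lt h
    have : ∑ j, z j ^ (l + n + 1) * (starRingEnd ℂ (z j)) ^ l = ∑ j, z j ^ (n + 1) := by
      refine Finset.sum_congr rfl fun j _ => ?_
      rw [add_assoc, pow_add, mul_right_comm, ← mul_pow, hzc, one_pow, one_mul]
    rw [this]
    exact hB _ (by omega) (by omega)

/-- Lower bound for a sum of squared geometric sums in terms of power sum bounds. -/
theorem le_sum_normSq_geom_sum {ι : Type*} [Fintype ι] {z : ι → ℂ} (hz : ∀ j, ‖z j‖ = 1)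
    {M : ℕ} {B : ℝ} (hB0 : 0 ≤ B) (hB : ∀ n : ℕ, 1 ≤ n → n < M → ‖∑ j, z j ^ n‖ ≤ B)
    {s : ℝ} (hs0 : 0 ≤ s) (hs1 : s ≤ 1) :
    Fintype.card ι * ∑ k ∈ Finset.range M, s ^ (2 * k) - M ^ 2 * (s * B) ≤
      ∑ j, Complex.normSq (∑ k ∈ Finset.range M, (z j * (s : ℂ)) ^ k) := by
  have hexp : ∀ j, Complex.normSq (∑ k ∈ Finset.range M, (z j * (s : ℂ)) ^ k)
      = ∑ k ∈ Finset.range M, ∑ l ∈ Finset.range M,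
          s ^ (k + l) * (z j ^ k * (starRingEnd ℂ (z j)) ^ l).re := by
    intro j
    have h1 : ((Complex.normSq (∑ k ∈ Finset.range M, (z j * (s : ℂ)) ^ k) : ℝ) : ℂ)
        = ∑ k ∈ Finset.range M, ∑ l ∈ Finset.range M,
          ((s ^ (k + l) : ℝ) : ℂ) * (z j ^ k * (starRingEnd ℂ (z j)) ^ l) := by
      rw [← Complex.mul_conj, map_sum, Finset.sum_mul_sum]
      refine Finset.sum_congr rfl fun k _ => Finset.sum_congr rfl fun l _ => ?_
      simp only [map_pow, map_mul, Complex.conj_ofReal]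
      push_cast
      ring
    have h2 := congrArg Complex.re h1
    simpa only [Complex.ofReal_re, Complex.re_sum, Complex.re_ofReal_mul] using h2
  have hterm : ∀ k ∈ Finset.range M, ∀ l ∈ Finset.range M,
      (if k = l then Fintype.card ι * s ^ (2 * k) else 0) - s * B ≤
        ∑ j, s ^ (k + l) * (z j ^ k * (starRingEnd ℂ (z j)) ^ l).re := by
    intro k hk l hl
    rw [← Finset.mul_sum, ← Complex.re_sum]
    split_ifs with h
    · subst h
      have : ∑ j, z j ^ k * (starRingEnd ℂ (z j)) ^ k = (Fintype.card ι : ℂ) := by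
        rw [Finset.sum_congr rfl (g := fun _ => (1 : ℂ))]
        · simp
        · intro j _
          rw [← mul_pow, Complex.mul_conj, Complex.normSq_eq_norm_sq, hz j]; simp
      rw [this, Complex.natCast_re, ← two_mul, mul_comm (s ^ _)]
      linarith [mul_nonneg hs0 hB0]
    · have hre := (abs_le.1 ((Complex.abs_re_le_norm _).trans (norm_sum_pow_mul_conj_pow_le hz hB
        (Finset.mem_range.1 hk) (Finset.mem_range.1 hl) h))).1
      have hpow : s ^ (k + l) ≤ s := pow_le_of_le_one hs0 hs1 (by omega)
      have h1 := mul_le_mul_of_nonneg_left hre (pow_nonneg hs0 (k + l))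
      have h2 := mul_le_mul_of_nonneg_right hpow hB0
      linarith
  calc _ = ∑ k ∈ Finset.range M, ∑ l ∈ Finset.range M,
        ((if k = l then Fintype.card ι * s ^ (2 * k) else 0) - s * B) := by
        simp only [Finset.sum_sub_distrib, Finset.sum_const, Finset.card_range, nsmul_eq_mul,
          Finset.sum_ite_eq, Finset.mul_sum]
        rw [Finset.sum_congr rfl fun k hk => if_pos hk]
        ring
    _ ≤ ∑ k ∈ Finset.range M, ∑ l ∈ Finset.range M,
        ∑ j, s ^ (k + l) * (z j ^ k * (starRingEnd ℂ (z j)) ^ l).re :=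
        Finset.sum_le_sum fun k hk => Finset.sum_le_sum fun l hl => hterm k hk l hl
    _ = _ := by
        simp only [hexp]
        rw [Finset.sum_comm (s := Finset.univ)]
        refine Finset.sum_congr rfl fun k _ => ?_
        rw [Finset.sum_comm]

/-- Bound for the logarithmic derivative of `∏ ‖1 - z j s‖` from power sum bounds. -/
theorem sum_sub_re_div_normSq_le {ι : Type*} [Fintype ι] {z : ι → ℂ} (hz : ∀ j, ‖z j‖ = 1)
    {M : ℕ} (hM : 1 ≤ M) {B : ℝ} (hB0 : 0 ≤ B)
    (hB : ∀ n : ℕ, 1 ≤ n → n < M → ‖∑ j, z j ^ n‖ ≤ B)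
    {s : ℝ} (hs0 : 0 < s) (hs1 : s < 1) :
    ∑ j, (s - (z j).re) / Complex.normSq (1 - z j * (s : ℂ)) ≤
      Fintype.card ι * (s ^ (M - 1) / (1 + s ^ M)) + M ^ 2 * B / 2 := by
  refine (Finset.sum_le_sum fun j _ => sub_re_div_normSq_le (hz j) hs0 hs1 M).trans ?_
  rw [← Finset.sum_div, Finset.sum_sub_distrib, ← Finset.sum_div, ← Finset.mul_sum]
  have hlow := le_sum_normSq_geom_sum hz hB0 hB hs0.le hs1.le
  set S := ∑ j, Complex.normSq (∑ k ∈ Finset.range M, (z j * (s : ℂ)) ^ k)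
  have hgeom : (∑ k ∈ Finset.range M, s ^ (2 * k)) * (1 - s ^ 2) = 1 - (s ^ M) ^ 2 := by
    simp only [pow_mul]
    rw [geom_sum_mul_neg, ← pow_mul, ← pow_mul, mul_comm]
  have hs2 : 0 ≤ 1 - s ^ 2 := by nlinarith
  have hs2' : 1 - s ^ 2 ≤ 1 := by nlinarith
  have h1 := mul_le_mul_of_nonneg_left hlow hs2
  have hE : 0 ≤ (M : ℝ) ^ 2 * (s * B) := by positivity
  have h2 : (Fintype.card ι : ℝ) * (1 - (s ^ M) ^ 2) - M ^ 2 * (s * B) ≤ (1 - s ^ 2) * S := by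
    rw [← hgeom]
    nlinarith [mul_le_mul_of_nonneg_right hs2' hE]
  have ht : 0 < s ^ M := by positivity
  have hpow : s ^ (M - 1) * s = s ^ M := by rw [← pow_succ, Nat.sub_add_cancel hM]
  have h3 : (Fintype.card ι : ℝ) * (1 - s ^ M) / (1 + s ^ M) - M ^ 2 * (s * B)
      ≤ (1 - s ^ 2) * S / (1 + s ^ M) ^ 2 := by
    rw [le_div_iff₀ (by positivity)]
    refine le_trans ?_ h2
    have : (Fintype.card ι : ℝ) * (1 - s ^ M) / (1 + s ^ M) * (1 + s ^ M) ^ 2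
        = (Fintype.card ι : ℝ) * (1 - (s ^ M) ^ 2) := by
      field_simp
      ring
    rw [sub_mul, this]
    nlinarith
  have hcard : ∑ _j : ι, (1 : ℝ) = Fintype.card ι := by simp
  rw [hcard, div_le_iff₀ (by positivity)]
  have h4 : (Fintype.card ι * (s ^ (M - 1) / (1 + s ^ M)) + M ^ 2 * B / 2) * (2 * s)
      = Fintype.card ι - (Fintype.card ι : ℝ) * (1 - s ^ M) / (1 + s ^ M) + M ^ 2 * (s * B) := by
    rw [← hpow]
    rw [← hpow] at ht
    field_simp
    ring
  rw [h4]
  linarith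

/-- A product of `1 - z j r` over points of the unit circle is controlled by its first `M - 1`
power sums, with main term `(log 2) / M` per factor. -/
theorem log_norm_prod_one_sub_le {ι : Type*} [Fintype ι] {z : ι → ℂ} (hz : ∀ j, ‖z j‖ = 1)
    {M : ℕ} (hM : 1 ≤ M) {B : ℝ} (hB0 : 0 ≤ B)
    (hB : ∀ n : ℕ, 1 ≤ n → n < M → ‖∑ j, z j ^ n‖ ≤ B)
    {r : ℝ} (hr0 : 0 ≤ r) (hr1 : r ≤ 1) :
    Real.log ‖∏ j, (1 - z j * (r : ℂ))‖ ≤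
      Fintype.card ι * (Real.log 2 / M) + M ^ 2 * B / 2 := by
  have hlog2 : 0 ≤ Real.log 2 := Real.log_nonneg one_le_two
  by_cases hprod : ∏ j, (1 - z j * (r : ℂ)) = 0
  · rw [hprod, norm_zero, Real.log_zero]
    positivity
  have hner : ∀ j, 1 - z j * (r : ℂ) ≠ 0 := fun j => Finset.prod_ne_zero_iff.1 hprod j (by simp)
  have hne : ∀ x ∈ Set.Icc 0 r, ∀ j, 1 - z j * (x : ℂ) ≠ 0 := by
    intro x hx j h
    rcases hx.2.eq_or_lt with rfl | hlt
    · exact hner j h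
    · have := congrArg norm (sub_eq_zero.1 h)
      rw [norm_one, norm_mul, hz j, one_mul, Complex.norm_real, Real.norm_of_nonneg hx.1] at this
      linarith
  have hM0 : (M : ℝ) ≠ 0 := by positivity
  set G : ℝ → ℝ := fun x => Fintype.card ι * (Real.log (1 + x ^ M) / M) + M ^ 2 * B / 2 * x
    - ∑ j, Real.log ‖1 - z j * (x : ℂ)‖ with hG
  have hderiv : ∀ x ∈ Set.Icc 0 r, HasDerivAt G
      (Fintype.card ι * (x ^ (M - 1) / (1 + x ^ M)) + M ^ 2 * B / 2
        - ∑ j, (x - (z j).re) / Complex.normSq (1 - z j * (x : ℂ))) x := by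
    intro x hx
    have hx0 : (1 + x ^ M : ℝ) ≠ 0 := by have := pow_nonneg hx.1 M; positivity
    have h1 : HasDerivAt (fun x : ℝ => Real.log (1 + x ^ M) / M) (x ^ (M - 1) / (1 + x ^ M)) x := by
      refine ((((hasDerivAt_pow M x).const_add 1).log hx0).div_const (M : ℝ)).congr_deriv ?_
      field_simp
    have h2 : HasDerivAt (fun x : ℝ => M ^ 2 * B / 2 * x) (M ^ 2 * B / 2) x := by
      simpa using (hasDerivAt_id x).const_mul ((M : ℝ) ^ 2 * B / 2)
    have h3 : HasDerivAt (fun x : ℝ => ∑ j, Real.log ‖1 - z j * (x : ℂ)‖)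
        (∑ j, (x - (z j).re) / Complex.normSq (1 - z j * (x : ℂ))) x :=
      HasDerivAt.fun_sum fun j _ => hasDerivAt_log_norm_one_sub_s6 (hz j) (hne x hx j)
    exact ((h1.const_mul _).add h2).sub h3
  have hmono : MonotoneOn G (Set.Icc 0 r) := by
    refine monotoneOn_of_deriv_nonneg (convex_Icc 0 r)
      (fun x hx => (hderiv x hx).continuousAt.continuousWithinAt) ?_ ?_
    · intro x hx
      exact (hderiv x (interior_subset hx)).differentiableAt.differentiableWithinAt
    · intro x hx
      rw [(hderiv x (interior_subset hx)).deriv]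
      rw [interior_Icc] at hx
      exact sub_nonneg.2 (sum_sub_re_div_normSq_le hz hM hB0 hB hx.1 (hx.2.trans_le hr1))
  have h0 : G 0 = 0 := by
    have : (M : ℕ) ≠ 0 := by omega
    simp [hG, this]
  have hGr : 0 ≤ G r := by
    rw [← h0]
    exact hmono ⟨le_rfl, hr0⟩ ⟨hr0, le_rfl⟩ hr0
  rw [norm_prod, Real.log_prod fun j _ => norm_ne_zero_iff.2 (hner j)]
  have hle1 : Real.log (1 + r ^ M) / M ≤ Real.log 2 / M := by
    have := pow_le_one₀ hr0 hr1 (n := M)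
    have := pow_nonneg hr0 M
    gcongr
    linarith
  have hle2 : M ^ 2 * B / 2 * r ≤ M ^ 2 * B / 2 := mul_le_of_le_one_right (by positivity) hr1
  have hle3 := mul_le_mul_of_nonneg_left hle1 (Nat.cast_nonneg (α := ℝ) (Fintype.card ι))
  simp only [hG] at hGr
  linarith

open Filter Topology in
/-- A power of `x` with exponent less than `1` beats powers of logarithms times `x / log x`. -/
theorem tendsto_log_error (q κ : ℝ) (hκ : κ < 2) :
    Tendsto (fun x : ℝ => (κ * (Real.log x / Real.log q) + 1) ^ 2 * (Real.log x / Real.log q)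
      * x ^ (κ / 2 - 1)) atTop (𝓝 0) := by
  have hs : 0 < 1 - κ / 2 := by linarith
  have key : ∀ n : ℕ, Tendsto (fun x : ℝ => Real.log x ^ n * x ^ (κ / 2 - 1)) atTop (𝓝 0) := by
    intro n
    refine (isLittleO_log_rpow_rpow_atTop (n : ℝ) hs).tendsto_div_nhds_zero.congr' ?_
    filter_upwards [eventually_gt_atTop 0] with x hx
    rw [Real.rpow_natCast, div_eq_mul_inv, ← Real.rpow_neg hx.le, neg_sub]
  have h := (((key 3).const_mul (κ ^ 2 / Real.log q ^ 3)).add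
    ((key 2).const_mul (2 * κ / Real.log q ^ 2))).add ((key 1).const_mul (1 / Real.log q))
  simp only [mul_zero, add_zero] at h
  refine h.congr fun x => ?_
  ring

/-- Lindelöf-type bound: if for each `d` the eigenangles satisfy the trace bounds
`|∑_j e^{inθ_j}| ≤ q^{-n/2}(1+q^n)`, then for every `ε > 0` there is `D` such that for
all `d ≥ D`, uniformly in `r ∈ [0,1]` and in a common rotation `c`,
`log |∏_j (1 - e^{i(θ_j - c)} r)| ≤ (log 2 / 2 + ε) d / log_q d`. -/
theorem stmt6 (q : ℝ) (hq : 2 ≤ q) (ε : ℝ) (hε : 0 < ε) :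
    ∃ D : ℕ, ∀ d : ℕ, D ≤ d → ∀ θ : Fin (d - 2) → ℝ,
      (∀ n : ℕ, 1 ≤ n →
        ‖∑ j, Complex.exp ((n : ℂ) * (θ j : ℂ) * Complex.I)‖
          ≤ q ^ (-(n : ℝ) / 2) * (1 + q ^ (n : ℝ))) →
      ∀ r : ℝ, 0 ≤ r → r ≤ 1 → ∀ c : ℝ,
        Real.log ‖∏ j, (1 - Complex.exp (((θ j - c : ℝ) : ℂ) * Complex.I) * (r : ℂ))‖
          ≤ (Real.log 2 / 2 + ε) * d / (Real.log d / Real.log q) := by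
  have hlog2 : 0 < Real.log 2 := Real.log_pos one_lt_two
  have hq0 : 0 < q := by linarith
  have hq1 : 1 ≤ q := by linarith
  have hlogq : 0 < Real.log q := Real.log_pos (by linarith)
  obtain ⟨κ, hκ0, hκ2, hκ⟩ : ∃ κ : ℝ, 0 < κ ∧ κ < 2 ∧ Real.log 2 / κ = Real.log 2 / 2 + ε / 2 := by
    refine ⟨Real.log 2 / (Real.log 2 / 2 + ε / 2), by positivity, ?_, ?_⟩
    · rw [div_lt_iff₀ (by positivity)]
      linarith
    · field_simp
  have htend := ((tendsto_log_error q κ hκ2).const_mul (q ^ (1 / 2 : ℝ))).comp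
    tendsto_natCast_atTop_atTop
  rw [mul_zero] at htend
  have hev := (htend.eventually_lt_const (half_pos hε)).and (Filter.eventually_ge_atTop 2)
  obtain ⟨D, hD⟩ := Filter.eventually_atTop.1 hev
  refine ⟨D, fun d hd θ hθ r hr0 hr1 c => ?_⟩
  obtain ⟨herr, hd2⟩ := hD d hd
  simp only [Function.comp] at herr
  have hd2' : (2 : ℝ) ≤ d := by exact_mod_cast hd2
  have hd0 : (0 : ℝ) < d := by linarith
  have hlogd : 0 < Real.log d := Real.log_pos (by linarith)
  set L := Real.log d / Real.log q with hL
  have hL0 : 0 < L := div_pos hlogd hlogq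
  set M := ⌈κ * L⌉₊ with hMdef
  have hM : 1 ≤ M := Nat.one_le_ceil_iff.2 (by positivity)
  have hMlow : κ * L ≤ M := Nat.le_ceil _
  have hMup : (M : ℝ) ≤ κ * L + 1 := (Nat.ceil_lt_add_one (by positivity)).le
  have hqM : q ^ ((M : ℝ) / 2) ≤ q ^ (1 / 2 : ℝ) * (d : ℝ) ^ (κ / 2) := by
    have hqL : (d : ℝ) ^ (κ / 2) = q ^ (κ * L / 2) := by
      rw [Real.rpow_def_of_pos hd0, Real.rpow_def_of_pos hq0, hL]
      congr 1
      field_simp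
    rw [hqL, ← Real.rpow_add hq0]
    exact Real.rpow_le_rpow_of_exponent_le hq1 (by linarith)
  have hmain := log_norm_prod_one_sub_le
    (z := fun j => Complex.exp (((θ j - c : ℝ) : ℂ) * Complex.I))
    (fun j => Complex.norm_exp_ofReal_mul_I _) hM (B := 2 * q ^ ((M : ℝ) / 2)) (by positivity)
    (by
      intro n hn hnM
      have hrot : ∑ j, Complex.exp (((θ j - c : ℝ) : ℂ) * Complex.I) ^ n
          = Complex.exp (((-(n * c) : ℝ) : ℂ) * Complex.I)
            * ∑ j, Complex.exp ((n : ℂ) * (θ j : ℂ) * Complex.I) := by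
        rw [Finset.mul_sum]
        refine Finset.sum_congr rfl fun j _ => ?_
        rw [← Complex.exp_nat_mul, ← Complex.exp_add]
        congr 1
        push_cast
        ring
      rw [hrot, norm_mul, Complex.norm_exp_ofReal_mul_I, one_mul]
      refine (hθ n hn).trans ?_
      rw [mul_add, mul_one, ← Real.rpow_add hq0, two_mul]
      have hn0 : (0 : ℝ) ≤ n := Nat.cast_nonneg n
      have hnM' : (n : ℝ) ≤ M := by exact_mod_cast hnM.le
      exact add_le_add (Real.rpow_le_rpow_of_exponent_le hq1 (by linarith))
        (Real.rpow_le_rpow_of_exponent_le hq1 (by linarith)))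
    hr0 hr1
  refine hmain.trans ?_
  rw [Fintype.card_fin]
  have hcard : ((d - 2 : ℕ) : ℝ) ≤ d := by exact_mod_cast Nat.sub_le d 2
  have hfirst : ((d - 2 : ℕ) : ℝ) * (Real.log 2 / M) ≤ (Real.log 2 / 2 + ε / 2) * d / L := by
    calc ((d - 2 : ℕ) : ℝ) * (Real.log 2 / M) ≤ d * (Real.log 2 / (κ * L)) := by gcongr
      _ = (Real.log 2 / κ) * d / L := by field_simp
      _ = _ := by rw [hκ]
  have hsecond : (M : ℝ) ^ 2 * (2 * q ^ ((M : ℝ) / 2)) / 2 ≤ ε / 2 * d / L := by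
    calc (M : ℝ) ^ 2 * (2 * q ^ ((M : ℝ) / 2)) / 2
        = (M : ℝ) ^ 2 * q ^ ((M : ℝ) / 2) := by ring
      _ ≤ (κ * L + 1) ^ 2 * (q ^ (1 / 2 : ℝ) * (d : ℝ) ^ (κ / 2)) := by gcongr
      _ = q ^ (1 / 2 : ℝ) * ((κ * L + 1) ^ 2 * L * (d : ℝ) ^ (κ / 2 - 1)) * d / L := by
        rw [Real.rpow_sub_one hd0.ne']
        field_simp
      _ ≤ ε / 2 * d / L := by gcongr
  calc _ ≤ (Real.log 2 / 2 + ε / 2) * d / L + ε / 2 * d / L := add_le_add hfirst hsecond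
    _ = _ := by ring
end

section
/- Let q > 1 and let f be an even Schwartz function with \hat{f} supported in [-\alpha,\alpha], 0 < \alpha < 1. Then \frac{1}{g}\sum_{n=1}^{\lfloor \alpha g\rfloor} \hat{f}(n/g) q^{-n} \sum_{deg v | n, deg v \neq 1} \frac{deg v}{1+q^{deg v}} = \frac{\hat{f}(0)}{g} \sum_{deg v \neq 1} \frac{deg v}{q^{2 deg v} - 1} + O(g^{-2+\varepsilon}) for every \varepsilon > 0, where sums over v run over places of \mathbb{F}_q(X). -/
noncomputable section

/-- Monic irreducible polynomials over `F`: the finite places of `F(X)`. -/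
def MonicIrred (F : Type) [Field F] : Type := {p : Polynomial F // p.Monic ∧ Irreducible p}

/-- Places of the rational function field `F(X)`: the monic irreducible polynomials
together with the place at infinity (`none`). -/
def FFPlace (F : Type) [Field F] : Type := Option (MonicIrred F)

/-- Degree of a place. -/
def FFPlace.deg {F : Type} [Field F] : FFPlace F → ℕ
  | none => 1
  | some p => p.1.natDegree

/-- Number of places of `F(X)` of degree `d`. -/
def Nplaces (F : Type) [Field F] (d : ℕ) : ℕ :=
  Nat.card {v : FFPlace F // v.deg = d}
/-- Rearranging a Lambert series: `∑ d, c d / (q ^ d - 1) = ∑ n, q⁻ⁿ ∑ d ∣ n, c d`. -/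
theorem hasSum_div_pow_sub_one {q : ℝ} (hq : 1 < q) {c : ℕ → ℝ} (hc0 : ∀ d, 0 ≤ c d)
    (hzero : c 0 = 0)
    (hs : Summable fun n : ℕ => (q ^ n)⁻¹ * ∑ d ∈ n.divisors, c d) :
    HasSum (fun d : ℕ => c d / (q ^ d - 1)) (∑' n : ℕ, (q ^ n)⁻¹ * ∑ d ∈ n.divisors, c d) := by
  have hq0 : 0 < q := by linarith
  let h : ℕ+ × ℕ+ → ℝ := fun p => c p.1 * (q ^ ((p.1 : ℕ) * p.2))⁻¹
  have h0 : ∀ p, 0 ≤ h p := fun p => mul_nonneg (hc0 _) (by positivity)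
  have hfib : ∀ n : ℕ+, ∑' x : Nat.divisorsAntidiagonal n, h (sigmaAntidiagonalEquivProd ⟨n, x⟩)
      = (q ^ (n : ℕ))⁻¹ * ∑ d ∈ (n : ℕ).divisors, c d := by
    intro n
    have : ∀ x : Nat.divisorsAntidiagonal n, h (sigmaAntidiagonalEquivProd ⟨n, x⟩)
        = c x.1.1 * (q ^ (n : ℕ))⁻¹ := by
      rintro ⟨⟨a, b⟩, hx⟩
      have hab := (Nat.mem_divisorsAntidiagonal.1 hx).1
      simp only at hab
      simp [h, sigmaAntidiagonalEquivProd, divisorsAntidiagonalFactors, hab]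
    simp_rw [this]
    rw [Finset.tsum_subtype (Nat.divisorsAntidiagonal n) (fun x => c x.1 * (q ^ (n : ℕ))⁻¹),
      ← Finset.sum_mul, mul_comm,
      Nat.sum_divisorsAntidiagonal (fun d _ => c d)]
  have hsP : Summable fun n : ℕ+ => (q ^ (n : ℕ))⁻¹ * ∑ d ∈ (n : ℕ).divisors, c d :=
    hs.comp_injective PNat.coe_injective
  have hsig : Summable (h ∘ sigmaAntidiagonalEquivProd) := by
    refine (summable_sigma_of_nonneg fun _ => h0 _).2 ⟨fun n => Summable.of_finite, ?_⟩
    simpa only [Function.comp, hfib] using hsP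
  have hsum : Summable h := sigmaAntidiagonalEquivProd.summable_iff.1 hsig
  have hpnat : ∀ {u : ℕ → ℝ} {a : ℝ}, u 0 = 0 →
      (HasSum (fun n : ℕ+ => u n) a ↔ HasSum u a) := by
    intro u a hu
    refine PNat.coe_injective.hasSum_iff fun n hn => ?_
    rcases Nat.eq_zero_or_pos n with rfl | hn0
    · exact hu
    · exact absurd ⟨⟨n, hn0⟩, rfl⟩ hn
  have htot : HasSum h (∑' n : ℕ, (q ^ n)⁻¹ * ∑ d ∈ n.divisors, c d) := by
    have h1 := (hpnat (by simp)).2 hs.hasSum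
    have h2 := hsig.tsum_sigma
    simp only [Function.comp_apply, hfib] at h2
    rw [← h1.tsum_eq, ← h2, sigmaAntidiagonalEquivProd.tsum_eq h]
    exact hsum.hasSum
  refine (hpnat (by simp [hzero])).1 (htot.prod_fiberwise fun d => ?_)
  have hr1 : (q ^ (d : ℕ))⁻¹ < 1 := inv_lt_one_of_one_lt₀ (one_lt_pow₀ hq d.ne_zero)
  have hgeo := hasSum_geometric_of_lt_one (r := (q ^ (d : ℕ))⁻¹) (by positivity) hr1
  have hgeo' : HasSum (fun k : ℕ+ => ((q ^ (d : ℕ))⁻¹) ^ (k : ℕ)) ((q ^ (d : ℕ) - 1)⁻¹) := by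
    rw [← hasSum_nat_add_iff' 1] at hgeo
    have hne : q ^ (d : ℕ) - 1 ≠ 0 := (sub_pos.2 (one_lt_pow₀ hq d.ne_zero)).ne'
    have hne' : q ^ (d : ℕ) ≠ 0 := by positivity
    have hval : (1 - (q ^ (d : ℕ))⁻¹)⁻¹ - ∑ i ∈ Finset.range 1, ((q ^ (d : ℕ))⁻¹) ^ i
        = (q ^ (d : ℕ) - 1)⁻¹ := by
      have : 1 - (q ^ (d : ℕ))⁻¹ ≠ 0 := (sub_pos.2 hr1).ne'
      have h2 : 1 - (q ^ (d : ℕ))⁻¹ = (q ^ (d : ℕ) - 1) / q ^ (d : ℕ) := by field_simp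
      rw [h2, Finset.sum_range_one, pow_zero, inv_div]
      field_simp
      ring
    rw [hval] at hgeo
    rw [← Equiv.pnatEquivNat.symm.hasSum_iff]
    simpa [Function.comp_def] using hgeo
  simpa [h, pow_mul, div_eq_mul_inv] using hgeo'.mul_left (c d)

theorem FFPlace.finite_and_card_le (F : Type) [Field F] [Fintype F] {d : ℕ} (hd : d ≠ 1) :
    Finite {v : FFPlace F // v.deg = d} ∧ Nplaces F d ≤ Fintype.card F ^ d := by
  let φ : {v : FFPlace F // v.deg = d} → (Fin d → F) := fun v i =>
    match v.1 with
    | none => 0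
    | some p => p.1.coeff i
  have hφ : Function.Injective φ := by
    rintro ⟨_ | p, hp⟩ ⟨_ | r, hr⟩ h
    · rfl
    · exact absurd hp.symm hd
    · exact absurd hr.symm hd
    · have hp' : p.1.natDegree = d := hp
      have hr' : r.1.natDegree = d := hr
      have : p = r := by
        refine Subtype.ext (Polynomial.ext fun n => ?_)
        rcases lt_trichotomy n d with hn | rfl | hn
        · exact congrFun h ⟨n, hn⟩
        · have h1 := p.2.1.coeff_natDegree
          have h2 := r.2.1.coeff_natDegree
          rw [hp'] at h1
          rw [hr'] at h2
          rw [h1, h2]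
        · rw [Polynomial.coeff_eq_zero_of_natDegree_lt (by omega),
            Polynomial.coeff_eq_zero_of_natDegree_lt (by omega)]
      subst this
      rfl
  refine ⟨Finite.of_injective φ hφ, ?_⟩
  have := Nat.card_le_card_of_injective φ hφ
  simpa [Nplaces, Nat.card_eq_fintype_card] using this

/-- Grouping the places of degree different from one by their degree. -/
theorem FFPlace.tsum_deg_ne_one (F : Type) [Field F] [Fintype F] {w : ℕ → ℝ} {a : ℝ}
    (hw : ∀ d, 0 ≤ w d)
    (h : HasSum (fun d : ℕ => if d = 1 then 0 else (Nplaces F d : ℝ) * w d) a) :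
    ∑' v : {v : FFPlace F // v.deg ≠ 1}, w (v : FFPlace F).deg = a := by
  let δ : {v : FFPlace F // v.deg ≠ 1} → ℕ := fun v => v.1.deg
  let e : ∀ d : ℕ, d ≠ 1 → {v // δ v = d} ≃ {v : FFPlace F // v.deg = d} := fun d hd =>
    { toFun := fun v => ⟨v.1.1, v.2⟩
      invFun := fun v => ⟨⟨v.1, fun h => hd (v.2.symm.trans h)⟩, v.2⟩
      left_inv := fun _ => rfl
      right_inv := fun _ => rfl }
  have hempty : IsEmpty {v // δ v = 1} := ⟨fun v => v.1.2 v.2⟩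
  have hfin : ∀ d, Finite {v // δ v = d} := by
    intro d
    by_cases hd : d = 1
    · subst hd; infer_instance
    · have := (FFPlace.finite_and_card_le F hd).1
      exact Finite.of_equiv _ (e d hd).symm
  have hfib : ∀ d, ∑' v : {v // δ v = d}, w (δ v.1)
      = if d = 1 then 0 else (Nplaces F d : ℝ) * w d := by
    intro d
    have : ∀ v : {v // δ v = d}, w (δ v.1) = w d := fun v => by rw [v.2]
    simp_rw [this]
    rw [tsum_const, nsmul_eq_mul]
    split_ifs with hd
    · subst hd; simp
    · rw [Nat.card_congr (e d hd), Nplaces]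
  have hsig : Summable fun x : Σ d, {v // δ v = d} => w (δ x.2.1) :=
    (summable_sigma_of_nonneg fun _ => hw _).2
      ⟨fun d => Summable.of_finite, by simpa only [hfib] using h.summable⟩
  calc ∑' v, w (δ v) = ∑' x : Σ d, {v // δ v = d}, w (δ x.2.1) :=
        ((Equiv.sigmaFiberEquiv δ).tsum_eq fun v => w (δ v)).symm
    _ = a := by rw [hsig.tsum_sigma, tsum_congr hfib, h.tsum_eq]

theorem summable_mul_inv_pow_mul_sum_divisors {q : ℝ} (hq : 1 < q) {c : ℕ → ℝ}
    (hc0 : ∀ d, 0 ≤ c d) (hc : ∀ d, c d ≤ d) :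
    Summable fun n : ℕ => (n : ℝ) * ((q ^ n)⁻¹ * ∑ d ∈ n.divisors, c d) := by
  have hq0 : 0 < q := by linarith
  have hgeo := summable_pow_mul_geometric_of_norm_lt_one 3 (r := q⁻¹)
    (by rw [Real.norm_of_nonneg (by positivity)]; exact inv_lt_one_of_one_lt₀ hq)
  refine hgeo.of_nonneg_of_le
    (fun n => by have := Finset.sum_nonneg fun d (_ : d ∈ n.divisors) => hc0 d; positivity)
    fun n => ?_
  have h1 : ∑ d ∈ n.divisors, c d ≤ (n : ℝ) * n := by
    calc ∑ d ∈ n.divisors, c d ≤ ∑ d ∈ n.divisors, (n : ℝ) :=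
          Finset.sum_le_sum fun d hd =>
            (hc d).trans (by exact_mod_cast Nat.divisor_le hd)
      _ = (n.divisors.card : ℝ) * n := by simp
      _ ≤ (n : ℝ) * n := by
          gcongr
          exact_mod_cast Nat.card_divisors_le_self n
  calc (n : ℝ) * ((q ^ n)⁻¹ * ∑ d ∈ n.divisors, c d)
      ≤ (n : ℝ) * ((q ^ n)⁻¹ * ((n : ℝ) * n)) := by gcongr
    _ = (n : ℝ) ^ 3 * q⁻¹ ^ n := by rw [inv_pow]; ring

/-- A weighted sum over `1 ≤ n ≤ α g` of a compactly supported function that is Lipschitz at `0`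
agrees with the full series, with its value at `0`, up to `O(1 / g)`. -/
theorem abs_sum_Icc_sub_le {α L : ℝ} {φ : ℝ → ℝ} {a : ℕ → ℝ}
    (hlip : ∀ x, |φ x - φ 0| ≤ L * |x|) (hsupp : ∀ x : ℝ, α < |x| → φ x = 0)
    (ha0 : ∀ n, 0 ≤ a n) (hzero : a 0 = 0) (hs : Summable a)
    (hs1 : Summable fun n : ℕ => (n : ℝ) * a n) {g : ℕ} (hg : 1 ≤ g) :
    |∑ n ∈ Finset.Icc 1 ⌊α * g⌋₊, φ ((n : ℝ) / g) * a n - φ 0 * ∑' n, a n|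
      ≤ L / g * ∑' n : ℕ, (n : ℝ) * a n := by
  have hg0 : (0 : ℝ) < g := by exact_mod_cast hg
  have hoff : ∀ n ∉ Finset.Icc 1 ⌊α * g⌋₊, φ ((n : ℝ) / g) * a n = 0 := by
    intro n hn
    rcases Nat.eq_zero_or_pos n with rfl | hn0
    · simp [hzero]
    · have : ⌊α * g⌋₊ < n := by
        by_contra hle
        exact hn (Finset.mem_Icc.2 ⟨hn0, not_lt.1 hle⟩)
      have hlt : α * g < n := (Nat.floor_lt' hn0.ne').1 this
      rw [hsupp, zero_mul]
      rw [abs_of_nonneg (by positivity), lt_div_iff₀ hg0]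
      exact hlt
  have hsumm : Summable fun n : ℕ => φ ((n : ℝ) / g) * a n :=
    summable_of_ne_finset_zero hoff
  rw [← tsum_eq_sum (L := .unconditional ℕ) hoff, ← tsum_mul_left, ← hsumm.tsum_sub (hs.mul_left _), ← tsum_mul_left]
  rw [← Real.norm_eq_abs]
  refine tsum_of_norm_bounded (hs1.mul_left _).hasSum fun n => ?_
  rw [← sub_mul, norm_mul, Real.norm_eq_abs, Real.norm_of_nonneg (ha0 n)]
  calc |φ ((n : ℝ) / g) - φ 0| * a n ≤ L * |(n : ℝ) / g| * a n :=
        mul_le_mul_of_nonneg_right (hlip _) (ha0 n)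
    _ = L / g * (n * a n) := by rw [abs_of_nonneg (by positivity)]; ring

/-- Main computation in the hyperelliptic one-level density: for `f̂` bounded,
Lipschitz near `0`, and supported in `[-α,α]` with `0 < α < 1`,
`(1/g) ∑_{n=1}^{⌊αg⌋} f̂(n/g) q^{-n} ∑_{deg v ∣ n, deg v ≠ 1} deg v/(1+q^{deg v})
 = (f̂(0)/g) ∑_{deg v ≠ 1} deg v/(q^{2 deg v}-1) + O(g^{-2+ε})`. -/
theorem stmt10 (F : Type) [Field F] [Fintype F] (α : ℝ) (hα0 : 0 < α) (hα1 : α < 1)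
    (fhat : ℝ → ℝ) (B L : ℝ)
    (hb : ∀ x, |fhat x| ≤ B)
    (hlip : ∀ x, |fhat x - fhat 0| ≤ L * |x|)
    (hsupp : ∀ x : ℝ, α < |x| → fhat x = 0)
    (ε : ℝ) (hε : 0 < ε) :
    ∃ C : ℝ, ∀ g : ℕ, 1 ≤ g →
      |(1 / (g : ℝ)) * ∑ n ∈ Finset.Icc 1 ⌊α * g⌋₊,
            fhat ((n : ℝ) / g) * ((Fintype.card F : ℝ) ^ n)⁻¹
              * ∑ d ∈ n.divisors.filter (fun d => d ≠ 1),
                  (Nplaces F d : ℝ) * d / (1 + (Fintype.card F : ℝ) ^ d)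
          - fhat 0 / g
              * ∑' v : {v : FFPlace F // FFPlace.deg v ≠ 1},
                  (FFPlace.deg (v : FFPlace F) : ℝ)
                    / ((Fintype.card F : ℝ) ^ (2 * FFPlace.deg (v : FFPlace F)) - 1)|
        ≤ C * (g : ℝ) ^ (-2 + ε) := by
  set q : ℝ := (Fintype.card F : ℝ) with hqdef
  have hq : 1 < q := by rw [hqdef]; exact_mod_cast Fintype.one_lt_card (α := F)
  have hq0 : 0 < q := by linarith
  let c : ℕ → ℝ := fun d => if d ≠ 1 then (Nplaces F d : ℝ) * d / (1 + q ^ d) else 0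
  have hc0 : ∀ d, 0 ≤ c d := fun d => by
    simp only [c]
    split_ifs <;> positivity
  have hc : ∀ d, c d ≤ d := fun d => by
    simp only [c]
    split_ifs with hd
    · rw [div_le_iff₀ (by positivity), mul_comm]
      have : (Nplaces F d : ℝ) ≤ q ^ d := by
        rw [hqdef]
        exact_mod_cast (FFPlace.finite_and_card_le F hd).2
      gcongr
      linarith
    · positivity
  let a : ℕ → ℝ := fun n => (q ^ n)⁻¹ * ∑ d ∈ n.divisors, c d
  have ha0 : ∀ n, 0 ≤ a n := fun n =>
    mul_nonneg (by positivity) (Finset.sum_nonneg fun d _ => hc0 d)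
  have hazero : a 0 = 0 := by simp [a]
  have hs1 : Summable fun n : ℕ => (n : ℝ) * a n :=
    summable_mul_inv_pow_mul_sum_divisors hq hc0 hc
  have hs : Summable a := by
    refine hs1.of_nonneg_of_le ha0 fun n => ?_
    rcases Nat.eq_zero_or_pos n with rfl | hn
    · simp [hazero]
    · exact le_mul_of_one_le_left (ha0 n) (by exact_mod_cast hn)
  have hplaces : ∑' v : {v : FFPlace F // FFPlace.deg v ≠ 1},
      (FFPlace.deg (v : FFPlace F) : ℝ) / (q ^ (2 * FFPlace.deg (v : FFPlace F)) - 1)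
        = ∑' n, a n := by
    refine FFPlace.tsum_deg_ne_one F (w := fun d : ℕ => (d : ℝ) / (q ^ (2 * d) - 1))
      (fun d => div_nonneg (by positivity) (sub_nonneg.2 (one_le_pow₀ hq.le))) ?_
    convert hasSum_div_pow_sub_one hq hc0 (by simp [c]) hs using 2 with d
    by_cases hd : d = 1
    · simp [c, hd]
    · have : q ^ (2 * d) - 1 = (1 + q ^ d) * (q ^ d - 1) := by ring
      simp only [c, hd, if_false, ne_eq, not_false_eq_true, if_true]
      rw [this, div_div, mul_div_assoc]
  have hL : 0 ≤ L := by simpa using (abs_nonneg _).trans (hlip 1)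
  have hS : 0 ≤ ∑' n : ℕ, (n : ℝ) * a n := tsum_nonneg fun n => mul_nonneg n.cast_nonneg (ha0 n)
  refine ⟨L * ∑' n : ℕ, (n : ℝ) * a n, fun g hg => ?_⟩
  have hg0 : (0 : ℝ) < g := by exact_mod_cast hg
  have hmain := abs_sum_Icc_sub_le hlip hsupp ha0 hazero hs hs1 hg
  rw [hplaces]
  simp only [Finset.sum_filter, mul_assoc]
  change |1 / (g : ℝ) * ∑ n ∈ Finset.Icc 1 ⌊α * g⌋₊, fhat ((n : ℝ) / g) * a n
    - fhat 0 / g * ∑' n, a n| ≤ _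
  have hpow : (g : ℝ) ^ (-2 : ℝ) ≤ (g : ℝ) ^ (-2 + ε) :=
    Real.rpow_le_rpow_of_exponent_le (by exact_mod_cast hg) (by linarith)
  calc |1 / (g : ℝ) * ∑ n ∈ Finset.Icc 1 ⌊α * g⌋₊, fhat ((n : ℝ) / g) * a n
        - fhat 0 / g * ∑' n, a n|
      = 1 / g * |∑ n ∈ Finset.Icc 1 ⌊α * g⌋₊, fhat ((n : ℝ) / g) * a n
        - fhat 0 * ∑' n, a n| := by
        rw [← abs_of_pos (one_div_pos.2 hg0), ← abs_mul, abs_of_pos (one_div_pos.2 hg0)]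
        congr 1
        ring
    _ ≤ 1 / g * (L / g * ∑' n : ℕ, (n : ℝ) * a n) := by gcongr
    _ = L * (∑' n : ℕ, (n : ℝ) * a n) * (g : ℝ) ^ (-2 : ℝ) := by
        rw [Real.rpow_neg hg0.le, Real.rpow_two]
        field_simp
    _ ≤ L * (∑' n : ℕ, (n : ℝ) * a n) * (g : ℝ) ^ (-2 + ε) := by gcongr
    _ = L * ((∑' n : ℕ, (n : ℝ) * a n) * (g : ℝ) ^ (-2 + ε)) := by ring
end
end
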